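/- Fix δ with 1/2 < δ < 1, set ε = 2δ − 1, c₁ = (4|S₁| + 1)/|2δ² − 1 − ε²| and c₂ = −Im(S₁)/|2δ² − 1 − ε²|. There exist constants C > 0 and x₀ such that for every real x ≥ x₀ with x^ε > q and log x > 2·log m/(1−ε), and every φ ∈ [0, 2π], writing s(φ) = 1 + (c₁ + i·c₂)/(log x)² + c₁·e^{iφ}/(4·(log x)²), one has |W_x(s(φ)) − (S₁ + (|S₁| + 1/4)·e^{iφ})/2| ≤ C/log x; in particular |W_x| is bounded above and below by positive constants on this circle. -/

import Mathlib

open Complex DirichletCharacter Finset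

lemma norm_ofReal_cpow_neg_sub_le {s : ℂ} (hs : 0 ≤ s.re) {y u : ℝ} (hy : 1 ≤ y) (hyu : y ≤ u)
    (hu : u ≤ y + 1) :
    ‖(y : ℂ) ^ (-s) - (u : ℂ) ^ (-s)‖ ≤ ‖s‖ * y ^ (-s.re - 1) := by
  have hd : ∀ v ∈ Set.Icc y u, HasDerivWithinAt (fun v : ℝ ↦ (v : ℂ) ^ (-s))
      (-s * (v : ℂ) ^ (-s - 1)) (Set.Icc y u) v := by
    intro v hv
    rcases eq_or_ne s 0 with rfl | h0
    · simpa using (hasDerivWithinAt_const v (Set.Icc y u) (1 : ℂ))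
    · have := hasDerivAt_ofReal_cpow_const' (x := v) (r := -s - 1) (by linarith [hv.1])
        (fun h ↦ h0 (by linear_combination -h))
      have h2 := (this.const_mul (-s)).hasDerivWithinAt (s := Set.Icc y u)
      refine h2.congr_of_mem (fun w _ ↦ ?_) hv
      have : -s - 1 + 1 = -s := by ring
      rw [this, mul_div_cancel₀ _ (neg_ne_zero.mpr h0)]
  have hb : ∀ v ∈ Set.Icc y u, ‖-s * (v : ℂ) ^ (-s - 1)‖ ≤ ‖s‖ * y ^ (-s.re - 1) := by
    intro v hv
    have hv0 : 0 < v := by linarith [hv.1]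
    rw [norm_mul, norm_neg, norm_cpow_eq_rpow_re_of_pos hv0]
    gcongr
    simp only [sub_re, neg_re, one_re]
    exact Real.rpow_le_rpow_of_nonpos (by linarith) hv.1 (by linarith)
  have := Convex.norm_image_sub_le_of_norm_hasDerivWithin_le hd hb (convex_Icc y u)
    (Set.right_mem_Icc.mpr hyu) (Set.left_mem_Icc.mpr hyu)
  refine this.trans ?_
  have h1 : ‖y - u‖ ≤ 1 := by rw [Real.norm_eq_abs, abs_le]; constructor <;> linarith
  have h0 : 0 ≤ ‖s‖ * y ^ (-s.re - 1) := by positivity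
  nlinarith

lemma norm_ofReal_cpow_neg_sub_le_rpow {s : ℂ} (hs : 0 ≤ s.re) {y u θ : ℝ} (hy : 1 ≤ y)
    (hyu : y ≤ u) (hu : u ≤ y + 1) (hθ : 0 ≤ θ) (hθ' : θ ≤ 1) :
    ‖(y : ℂ) ^ (-s) - (u : ℂ) ^ (-s)‖ ≤ 2 * (‖s‖ ^ θ * y ^ (-s.re - θ)) := by
  have hy0 : 0 < y := by linarith
  have hu0 : 0 < u := by linarith
  have hkey : ‖s‖ ^ θ * y ^ (-s.re - θ) = y ^ (-s.re) * (‖s‖ / y) ^ θ := by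
    rw [Real.div_rpow (norm_nonneg _) hy0.le, Real.rpow_sub hy0]; ring
  rw [hkey]
  have hp : 0 < y ^ (-s.re) := Real.rpow_pos_of_pos hy0 _
  rcases le_total ‖s‖ y with h | h
  · refine (norm_ofReal_cpow_neg_sub_le hs hy hyu hu).trans ?_
    rw [Real.rpow_sub hy0, Real.rpow_one]
    have h1 : ‖s‖ / y ≤ (‖s‖ / y) ^ θ :=
      Real.self_le_rpow_of_le_one (by positivity) ((div_le_one hy0).mpr h) hθ'
    have h2 : 0 ≤ ‖s‖ / y := by positivity
    calc ‖s‖ * (y ^ (-s.re) / y) = y ^ (-s.re) * (‖s‖ / y) := by ring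
      _ ≤ y ^ (-s.re) * (‖s‖ / y) ^ θ := by gcongr
      _ ≤ _ := by nlinarith [mul_nonneg hp.le (h2.trans h1)]
  · have h1 : 1 ≤ (‖s‖ / y) ^ θ := Real.one_le_rpow ((one_le_div hy0).mpr h) hθ
    refine (norm_sub_le _ _).trans ?_
    rw [norm_cpow_eq_rpow_re_of_pos hy0, norm_cpow_eq_rpow_re_of_pos hu0, neg_re]
    have h3 : u ^ (-s.re) ≤ y ^ (-s.re) :=
      Real.rpow_le_rpow_of_nonpos hy0 hyu (by linarith)
    nlinarith

/-- The difference between `y ^ (-s)` and the integral of `u ^ (-s)` over `[y, y + 1]`. -/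
noncomputable def cpowGap (y : ℝ) (s : ℂ) : ℂ :=
  (y : ℂ) ^ (-s) - ((y : ℂ) ^ (1 - s) - ((y + 1 : ℝ) : ℂ) ^ (1 - s)) / (s - 1)

lemma norm_cpowGap_le {s : ℂ} (hs : 0 ≤ s.re) (hs1 : s ≠ 1) {y θ : ℝ} (hy : 1 ≤ y)
    (hθ : 0 ≤ θ) (hθ' : θ ≤ 1) :
    ‖cpowGap y s‖ ≤ 2 * (‖s‖ ^ θ * y ^ (-s.re - θ)) := by
  have hs1' : s - 1 ≠ 0 := sub_ne_zero.mpr hs1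
  have hd : ∀ v ∈ Set.Icc y (y + 1), HasDerivWithinAt
      (fun v : ℝ ↦ (v : ℂ) * (y : ℂ) ^ (-s) + (v : ℂ) ^ (1 - s) / (s - 1))
      ((y : ℂ) ^ (-s) - (v : ℂ) ^ (-s)) (Set.Icc y (y + 1)) v := by
    intro v hv
    have h1 := hasDerivAt_ofReal_cpow_const' (x := v) (r := -s) (by linarith [hv.1])
        (by intro h; apply hs1; linear_combination -h)
    have h2 : HasDerivAt (fun v : ℝ ↦ (v : ℂ)) 1 v := ofRealCLM.hasDerivAt
    have h3 := ((h2.mul_const ((y : ℂ) ^ (-s))).sub h1).hasDerivWithinAt (s := Set.Icc y (y + 1))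
    rw [one_mul] at h3
    refine h3.congr_of_mem (fun w _ ↦ ?_) hv
    have e : -s + 1 = 1 - s := by ring
    have e2 : (1 - s) ≠ 0 := by intro h; apply hs1'; linear_combination -h
    simp only [Pi.sub_apply, e]
    field_simp
    ring
  have hb : ∀ v ∈ Set.Icc y (y + 1), ‖(y : ℂ) ^ (-s) - (v : ℂ) ^ (-s)‖ ≤
      2 * (‖s‖ ^ θ * y ^ (-s.re - θ)) := fun v hv ↦
    norm_ofReal_cpow_neg_sub_le_rpow hs hy hv.1 hv.2 hθ hθ'
  have := Convex.norm_image_sub_le_of_norm_hasDerivWithin_le hd hb (convex_Icc y (y + 1))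
    (Set.left_mem_Icc.mpr (by linarith)) (Set.right_mem_Icc.mpr (by linarith))
  have e : ‖(y + 1) - y‖ = 1 := by simp
  rw [e, mul_one] at this
  refine le_trans (le_of_eq ?_) this
  congr 1
  rw [cpowGap]
  push_cast
  ring

lemma differentiableAt_cpowGap {y : ℝ} (hy : 0 < y) {s : ℂ} (hs : s ≠ 1) :
    DifferentiableAt ℂ (cpowGap y) s := by
  have hs1' : s - 1 ≠ 0 := sub_ne_zero.mpr hs
  have hy' : (y : ℂ) ≠ 0 := by exact_mod_cast hy.ne'
  have hy1 : ((y + 1 : ℝ) : ℂ) ≠ 0 := by exact_mod_cast (by linarith : y + 1 ≠ 0)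
  unfold cpowGap
  refine DifferentiableAt.sub (DifferentiableAt.const_cpow (by fun_prop) (.inl hy'))
    (DifferentiableAt.div (DifferentiableAt.sub ?_ ?_) (by fun_prop) hs1')
  · exact DifferentiableAt.const_cpow (by fun_prop) (.inl hy')
  · exact DifferentiableAt.const_cpow (by fun_prop) (.inl hy1)

lemma hurwitzZeta_eq_tsum_cpowGap_of_one_lt_re {a : ℝ} (ha : a ∈ Set.Icc 0 1) {s : ℂ}
    (hs : 1 < s.re) :
    HurwitzZeta.hurwitzZeta a s = 1 / (a : ℂ) ^ s + ((1 + a : ℝ) : ℂ) ^ (1 - s) / (s - 1) +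
      ∑' n : ℕ, cpowGap (n + 1 + a) s := by
  have h := HurwitzZeta.hasSum_hurwitzZeta_of_one_lt_re ha hs
  have h1 := (hasSum_nat_add_iff' 1).mpr h
  simp only [range_one, sum_singleton, CharP.cast_eq_zero, zero_add] at h1
  have h0 (n : ℕ) : 0 < (n : ℝ) + 1 + a := by have := ha.1; positivity
  have hlim : Filter.Tendsto (fun n : ℕ ↦ ((n + 1 + a : ℝ) : ℂ) ^ (1 - s)) Filter.atTop
      (nhds 0) := by
    rw [tendsto_zero_iff_norm_tendsto_zero]
    have : Filter.Tendsto (fun n : ℕ ↦ (n + 1 + a : ℝ)) Filter.atTop Filter.atTop := by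
      refine Filter.tendsto_atTop_add_const_right _ _ (Filter.tendsto_atTop_add_const_right _ _ ?_)
      exact tendsto_natCast_atTop_atTop
    have h3 := (tendsto_rpow_neg_atTop (y := s.re - 1) (by linarith)).comp this
    refine h3.congr fun n ↦ ?_
    rw [norm_cpow_eq_rpow_re_of_pos (h0 n)]
    simp
  have h2 : HasSum (fun n : ℕ ↦ ((n + 1 + a : ℝ) : ℂ) ^ (1 - s) -
      (((n + 1 : ℕ) + 1 + a : ℝ) : ℂ) ^ (1 - s)) (((1 + a : ℝ) : ℂ) ^ (1 - s)) := by
    have hsum : Summable (fun n : ℕ ↦ ((n + 1 + a : ℝ) : ℂ) ^ (1 - s) -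
      (((n + 1 : ℕ) + 1 + a : ℝ) : ℂ) ^ (1 - s)) := by
      have hbd : Summable (fun n : ℕ ↦ ‖s - 1‖ * ((n + 1 : ℕ) : ℝ) ^ (-s.re)) := by
        refine Summable.mul_left _ ?_
        exact (summable_nat_add_iff 1).mpr (Real.summable_nat_rpow.mpr (by linarith))
      refine Summable.of_norm_bounded hbd fun n ↦ ?_
      have h5 := norm_ofReal_cpow_neg_sub_le (s := s - 1) (y := n + 1 + a) (u := n + 1 + a + 1)
        (by simp; linarith) (by have := ha.1; have : (0:ℝ) ≤ n := n.cast_nonneg; linarith)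
        (by linarith) le_rfl
      have e : -(s - 1) = 1 - s := by ring
      rw [e] at h5
      have e2 : ((n + 1 : ℕ) : ℝ) + 1 + a = n + 1 + a + 1 := by push_cast; ring
      rw [e2]
      refine h5.trans ?_
      gcongr
      have e3 : -(s - 1).re - 1 = -s.re := by simp
      rw [e3]
      push_cast
      exact Real.rpow_le_rpow_of_nonpos (by positivity) (by linarith [ha.1]) (by linarith)
    rw [hsum.hasSum_iff_tendsto_nat]
    have h4 : ∀ n : ℕ, ∑ i ∈ range n, (((i + 1 + a : ℝ) : ℂ) ^ (1 - s) -
      (((i + 1 : ℕ) + 1 + a : ℝ) : ℂ) ^ (1 - s)) = ((1 + a : ℝ) : ℂ) ^ (1 - s)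
        - ((n + 1 + a : ℝ) : ℂ) ^ (1 - s) := by
      intro n
      have := Finset.sum_range_sub' (fun i : ℕ ↦ ((i + 1 + a : ℝ) : ℂ) ^ (1 - s)) n
      simpa using this
    simp_rw [h4]
    simpa using hlim.const_sub (((1 + a : ℝ) : ℂ) ^ (1 - s))
  have h3 := h1.sub (h2.div_const (s - 1))
  have e : ∀ n : ℕ, cpowGap (n + 1 + a) s = 1 / ((n + 1 : ℕ) + a : ℂ) ^ s -
      (((n + 1 + a : ℝ) : ℂ) ^ (1 - s) - (((n + 1 : ℕ) + 1 + a : ℝ) : ℂ) ^ (1 - s)) / (s - 1) := by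
    intro n
    rw [cpowGap, cpow_neg, one_div]
    push_cast
    ring_nf
  simp_rw [e]
  rw [h3.tsum_eq]
  ring

lemma hurwitzZeta_growth {a : ℝ} (ha : a ∈ Set.Icc 0 1) :
    ∃ C : ℝ, 0 < C ∧ ∀ s : ℂ, 31 / 32 < s.re → s.re ≤ 3 → 1 / 2 ≤ |s.im| →
      ‖HurwitzZeta.hurwitzZeta a s‖ ≤ C * |s.im| ^ (1 / 16 : ℝ) := by
  set S : ℝ := ∑' n : ℕ, ((n + 1 : ℕ) : ℝ) ^ (-(33 / 32) : ℝ) with hS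
  have hSsum : Summable fun n : ℕ ↦ ((n + 1 : ℕ) : ℝ) ^ (-(33 / 32) : ℝ) :=
    (summable_nat_add_iff 1).mpr (Real.summable_nat_rpow.mpr (by norm_num))
  have hS0 : 0 ≤ S := tsum_nonneg fun n ↦ by positivity
  -- termwise bound
  have hterm : ∀ (n : ℕ) (s : ℂ), 31 / 32 < s.re → s ≠ 1 →
      ‖cpowGap (n + 1 + a) s‖ ≤ 2 * ‖s‖ ^ (1 / 16 : ℝ) * ((n + 1 : ℕ) : ℝ) ^ (-(33 / 32) : ℝ) := by
    intro n s hs hs1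
    have hn : (0 : ℝ) ≤ n := n.cast_nonneg
    have ha0 := ha.1
    refine (norm_cpowGap_le (by linarith) hs1 (θ := 1 / 16) (by linarith) (by norm_num)
      (by norm_num)).trans ?_
    rw [← mul_assoc]
    gcongr
    push_cast
    calc ((n : ℝ) + 1 + a) ^ (-s.re - 1 / 16) ≤ ((n : ℝ) + 1) ^ (-s.re - 1 / 16) :=
          Real.rpow_le_rpow_of_nonpos (by positivity) (by linarith) (by linarith)
      _ ≤ _ := Real.rpow_le_rpow_of_exponent_le (by linarith) (by linarith)
  -- the formula on each half plane
  have hform : ∀ s : ℂ, 31 / 32 < s.re → s.im ≠ 0 →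
      HurwitzZeta.hurwitzZeta a s = 1 / (a : ℂ) ^ s + ((1 + a : ℝ) : ℂ) ^ (1 - s) / (s - 1) +
      ∑' n : ℕ, cpowGap (n + 1 + a) s := by
    intro s hs him
    set σ : ℝ := ((SignType.sign s.im : SignType) : ℝ) with hσ
    have hσim : 0 < σ * s.im := by
      rw [hσ, sign_mul_self]; exact abs_pos.mpr him
    set B : ℝ := ‖s‖ + 3 with hB
    have hB0 : 0 ≤ B := by positivity
    let U : Set ℂ := {z | 31 / 32 < z.re} ∩ {z | 0 < σ * z.im} ∩ Metric.ball 0 B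
    have hUo : IsOpen U := ((isOpen_lt continuous_const continuous_re).inter
      (isOpen_lt continuous_const (continuous_const.mul continuous_im))).inter Metric.isOpen_ball
    have hUc : Convex ℝ U := by
      refine ((convex_halfSpace_re_gt _).inter ?_).inter (convex_ball _ _)
      exact convex_halfSpace_gt (f := fun z : ℂ ↦ σ * z.im)
        ⟨fun x y ↦ by simp [mul_add], fun c x ↦ by simp [mul_left_comm]⟩ 0
    have hU1 : ∀ z ∈ U, z ≠ 1 := by
      rintro z ⟨⟨-, hz⟩, -⟩ rfl
      simp at hz
    have hU0 : ∀ z ∈ U, z ≠ 0 := by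
      rintro z ⟨⟨-, hz⟩, -⟩ rfl
      simp at hz
    have hd1 : DifferentiableOn ℂ (HurwitzZeta.hurwitzZeta a) U := fun z hz ↦
      (HurwitzZeta.differentiableAt_hurwitzZeta a (hU1 z hz)).differentiableWithinAt
    have hd2 : DifferentiableOn ℂ (fun s ↦ 1 / (a : ℂ) ^ s + ((1 + a : ℝ) : ℂ) ^ (1 - s) / (s - 1) +
        ∑' n : ℕ, cpowGap (n + 1 + a) s) U := by
      refine DifferentiableOn.add (fun z hz ↦ DifferentiableAt.differentiableWithinAt ?_) ?_
      · have hz1 : z - 1 ≠ 0 := sub_ne_zero.mpr (hU1 z hz)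
        have hne : ((1 + a : ℝ) : ℂ) ≠ 0 := by
          exact_mod_cast (by linarith [ha.1] : 1 + a ≠ 0)
        refine DifferentiableAt.add ?_ (DifferentiableAt.div
          (DifferentiableAt.const_cpow (by fun_prop) (.inl hne)) (by fun_prop) hz1)
        rcases eq_or_ne (a : ℂ) 0 with h | h
        · rw [h]
          refine (differentiableAt_const (0 : ℂ)).congr_of_eventuallyEq ?_
          filter_upwards [hUo.mem_nhds hz] with w hw
          rw [zero_cpow (hU0 w hw), div_zero]
        · exact DifferentiableAt.div (by fun_prop)
            (DifferentiableAt.const_cpow (by fun_prop) (.inl h))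
            (by simp [cpow_eq_zero_iff, h])
      · refine differentiableOn_tsum_of_summable_norm (hSsum.mul_left (2 * B ^ (1 / 16 : ℝ)))
          (fun n z hz ↦ (differentiableAt_cpowGap ?_ (hU1 z hz)).differentiableWithinAt) hUo ?_
        · have := ha.1; positivity
        · intro n z hz
          refine (hterm n z hz.1.1 (hU1 z hz)).trans ?_
          have : ‖z‖ ≤ B := by simpa using (Metric.mem_ball.mp hz.2).le
          gcongr
    have hz0 : (2 + σ * I : ℂ) ∈ U := by
      have hσ2 : σ * σ = 1 := by
        rcases lt_or_gt_of_ne him with h | h <;> simp [hσ, h]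
      have hσ1 : |σ| = 1 := by
        have : |σ| * |σ| = 1 := by rw [abs_mul_abs_self, hσ2]
        nlinarith [abs_nonneg σ]
      refine ⟨⟨?_, ?_⟩, ?_⟩
      · simp; norm_num
      · simp [hσ2]
      · simp only [Metric.mem_ball, dist_zero_right]
        have hsp : 0 < ‖s‖ := norm_pos_iff.mpr (by rintro rfl; simp at him)
        calc ‖(2 + σ * I : ℂ)‖ ≤ ‖(2:ℂ)‖ + ‖(σ * I : ℂ)‖ := norm_add_le _ _
          _ = 3 := by simp [hσ1]; norm_num
          _ < B := by linarith
    refine AnalyticOnNhd.eqOn_of_preconnected_of_eventuallyEq (hd1.analyticOnNhd hUo)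
      (hd2.analyticOnNhd hUo) hUc.isPreconnected hz0 ?_ ⟨⟨hs, hσim⟩, ?_⟩
    · have : {z : ℂ | 1 < z.re} ∈ nhds (2 + σ * I : ℂ) :=
        (isOpen_lt continuous_const continuous_re).mem_nhds (by simp)
      filter_upwards [this] with z hz
      exact hurwitzZeta_eq_tsum_cpowGap_of_one_lt_re ha hz
    · simp [hB]
  set A : ℝ := if a = 0 then 0 else a⁻¹ ^ (3 : ℝ) with hA
  have hA0 : 0 ≤ A := by
    rw [hA]; split_ifs
    · exact le_rfl
    · have := ha.1; positivity
  refine ⟨2 * A + 8 + 100 * S, by positivity, fun s hs1 hs2 hs3 ↦ ?_⟩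
  have him : s.im ≠ 0 := by intro h; rw [h] at hs3; norm_num at hs3
  have hsne : s ≠ 1 := by rintro rfl; simp at him
  have ht : (1 / 2 : ℝ) ≤ |s.im| ^ (1 / 16 : ℝ) := by
    calc (1 / 2 : ℝ) ≤ (1 / 2 : ℝ) ^ (1 / 16 : ℝ) :=
          Real.self_le_rpow_of_le_one (by norm_num) (by norm_num) (by norm_num)
      _ ≤ _ := Real.rpow_le_rpow (by norm_num) hs3 (by norm_num)
  rw [hform s hs1 him]
  have b1 : ‖1 / (a : ℂ) ^ s‖ ≤ A := by
    rw [hA]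
    split_ifs with h
    · rw [h]; simp [zero_cpow (show s ≠ 0 by rintro rfl; simp at him)]
    · have ha0 : 0 < a := lt_of_le_of_ne ha.1 (Ne.symm h)
      rw [norm_div, norm_one, norm_cpow_eq_rpow_re_of_pos ha0, one_div, ← Real.inv_rpow ha0.le]
      exact Real.rpow_le_rpow_of_exponent_le ((one_le_inv₀ ha0).mpr ha.2) hs2
  have b2 : ‖((1 + a : ℝ) : ℂ) ^ (1 - s) / (s - 1)‖ ≤ 4 := by
    have ha0 := ha.1
    rw [norm_div, norm_cpow_eq_rpow_re_of_pos (by linarith)]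
    have h1 : (1 + a) ^ (1 - s).re ≤ 2 := by
      calc (1 + a) ^ (1 - s).re ≤ (1 + a) ^ (1 : ℝ) :=
            Real.rpow_le_rpow_of_exponent_le (by linarith) (by simp; linarith)
        _ ≤ 2 := by rw [Real.rpow_one]; linarith [ha.2]
    have h2 : 1 / 2 ≤ ‖s - 1‖ := by
      refine hs3.trans ?_
      simpa using abs_im_le_norm (s - 1)
    rw [div_le_iff₀ (by linarith)]
    linarith
  have b3 : ‖∑' n : ℕ, cpowGap (n + 1 + a) s‖ ≤ 2 * ‖s‖ ^ (1 / 16 : ℝ) * S :=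
    tsum_of_norm_bounded (hSsum.hasSum.mul_left _) fun n ↦ hterm n s hs1 hsne
  have b4 : ‖s‖ ^ (1 / 16 : ℝ) ≤ 7 * |s.im| ^ (1 / 16 : ℝ) := by
    have h : ‖s‖ ≤ 7 * |s.im| := by
      have := norm_le_abs_re_add_abs_im s
      rw [abs_of_pos (by linarith : 0 < s.re)] at this
      linarith
    calc ‖s‖ ^ (1 / 16 : ℝ) ≤ (7 * |s.im|) ^ (1 / 16 : ℝ) :=
          Real.rpow_le_rpow (norm_nonneg _) h (by norm_num)
      _ = 7 ^ (1 / 16 : ℝ) * |s.im| ^ (1 / 16 : ℝ) := Real.mul_rpow (by norm_num) (abs_nonneg _)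
      _ ≤ _ := by
        gcongr
        calc (7 : ℝ) ^ (1 / 16 : ℝ) ≤ 7 ^ (1 : ℝ) :=
              Real.rpow_le_rpow_of_exponent_le (by norm_num) (by norm_num)
          _ = 7 := Real.rpow_one _
  calc _ ≤ A + 4 + 2 * ‖s‖ ^ (1 / 16 : ℝ) * S :=
        (norm_add₃_le).trans (add_le_add (add_le_add b1 b2) b3)
    _ ≤ A + 4 + 2 * (7 * |s.im| ^ (1 / 16 : ℝ)) * S := by gcongr
    _ ≤ _ := by nlinarith [mul_nonneg (by linarith : (0:ℝ) ≤ |s.im| ^ (1 / 16 : ℝ)) hS0]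

lemma LFunction_growth {N : ℕ} [NeZero N] (χ : DirichletCharacter ℂ N) :
    ∃ C : ℝ, 0 < C ∧ ∀ s : ℂ, 31 / 32 < s.re → s.re ≤ 3 → 1 / 2 ≤ |s.im| →
      ‖LFunction χ s‖ ≤ C * |s.im| ^ (1 / 16 : ℝ) := by
  have h (j : ZMod N) : ∃ C : ℝ, 0 < C ∧ ∀ s : ℂ, 31 / 32 < s.re → s.re ≤ 3 → 1 / 2 ≤ |s.im| →
      ‖HurwitzZeta.hurwitzZeta (ZMod.toAddCircle j) s‖ ≤ C * |s.im| ^ (1 / 16 : ℝ) := by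
    have hmem : (j.val / N : ℝ) ∈ Set.Icc 0 1 :=
      ⟨by positivity, div_le_one_of_le₀ (mod_cast j.val_lt.le) (by positivity)⟩
    simpa [ZMod.toAddCircle_apply] using hurwitzZeta_growth hmem
  choose C hC0 hC using h
  refine ⟨∑ j, C j, sum_pos (fun j _ ↦ hC0 j) univ_nonempty, fun s hs1 hs2 hs3 ↦ ?_⟩
  rw [LFunction, ZMod.LFunction, norm_mul]
  have hN : ‖(N : ℂ) ^ (-s)‖ ≤ 1 := by
    rw [norm_natCast_cpow_of_pos (NeZero.pos N)]
    exact Real.rpow_le_one_of_one_le_of_nonpos (mod_cast NeZero.one_le) (by simp; linarith)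
  calc _ ≤ 1 * ∑ j, C j * |s.im| ^ (1 / 16 : ℝ) := by
        gcongr
        refine (norm_sum_le _ _).trans (sum_le_sum fun j _ ↦ ?_)
        rw [norm_mul]
        calc _ ≤ 1 * ‖HurwitzZeta.hurwitzZeta (ZMod.toAddCircle j) s‖ := by
              gcongr; exact χ.norm_le_one j
          _ ≤ _ := by rw [one_mul]; exact hC j s hs1 hs2 hs3
    _ = _ := by rw [one_mul, sum_mul]

lemma iteratedDeriv_LFunction_growth {N : ℕ} [NeZero N] (χ : DirichletCharacter ℂ N) :
    ∃ C : ℝ, 1 ≤ C ∧ ∀ j ≤ 3, ∀ s : ℂ, 1 ≤ s.re → s.re ≤ 2 → 1 ≤ |s.im| →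
      ‖iteratedDeriv j (LFunction χ) s‖ ≤ C * |s.im| ^ (1 / 16 : ℝ) := by
  obtain ⟨C, hC0, hC⟩ := LFunction_growth χ
  refine ⟨6 * (2 * C) * 64 ^ 3 + 1, by nlinarith, fun j hj s h1 h2 h3 ↦ ?_⟩
  have hball : ∀ z ∈ Metric.closedBall s (1 / 64), 31 / 32 < z.re ∧ z.re ≤ 3 ∧ 1 / 2 ≤ |z.im| ∧
      |z.im| ≤ 2 * |s.im| := by
    intro z hz
    rw [mem_closedBall_iff_norm] at hz
    have hr := (abs_re_le_norm (z - s)).trans hz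
    have hi := (abs_im_le_norm (z - s)).trans hz
    rw [sub_re, abs_le] at hr
    rw [sub_im] at hi
    have h4 := abs_sub_abs_le_abs_sub z.im s.im
    have h5 := abs_sub_abs_le_abs_sub s.im z.im
    rw [abs_sub_comm] at h5
    refine ⟨by linarith [hr.1], by linarith [hr.2], by linarith, by linarith⟩
  have hd : DiffContOnCl ℂ (LFunction χ) (Metric.ball s (1 / 64)) := by
    refine DifferentiableOn.diffContOnCl_ball (U := Metric.closedBall s (1 / 64)) ?_ le_rfl
    intro z hz
    refine (differentiableAt_LFunction χ z (.inl ?_)).differentiableWithinAt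
    rintro rfl
    have := (hball 1 hz).2.2.1
    norm_num at this
  have hb := norm_iteratedDeriv_le_of_forall_mem_sphere_norm_le j (by norm_num) hd
    (C := 2 * C * |s.im| ^ (1 / 16 : ℝ)) (fun z hz ↦ by
      obtain ⟨a1, a2, a3, a4⟩ := hball z (Metric.sphere_subset_closedBall hz)
      refine (hC z a1 a2 a3).trans ?_
      have : |z.im| ^ (1 / 16 : ℝ) ≤ 2 * |s.im| ^ (1 / 16 : ℝ) := by
        calc |z.im| ^ (1 / 16 : ℝ) ≤ (2 * |s.im|) ^ (1 / 16 : ℝ) :=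
              Real.rpow_le_rpow (abs_nonneg _) a4 (by norm_num)
          _ = 2 ^ (1 / 16 : ℝ) * |s.im| ^ (1 / 16 : ℝ) := Real.mul_rpow (by norm_num) (abs_nonneg _)
          _ ≤ _ := by
            gcongr
            calc (2 : ℝ) ^ (1 / 16 : ℝ) ≤ 2 ^ (1 : ℝ) :=
                  Real.rpow_le_rpow_of_exponent_le (by norm_num) (by norm_num)
              _ = 2 := Real.rpow_one _
      nlinarith)
  refine hb.trans ?_
  have hf : (j.factorial : ℝ) ≤ 6 := by
    have := Nat.factorial_le hj
    exact_mod_cast this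
  have hp : (1 / 64 : ℝ) ^ 3 ≤ (1 / 64) ^ j := pow_le_pow_of_le_one (by norm_num) (by norm_num) hj
  have hs0 : 0 ≤ |s.im| ^ (1 / 16 : ℝ) := by positivity
  calc _ ≤ 6 * (2 * C * |s.im| ^ (1 / 16 : ℝ)) / (1 / 64) ^ 3 := by gcongr
    _ = (6 * (2 * C) * 64 ^ 3) * |s.im| ^ (1 / 16 : ℝ) := by ring
    _ ≤ _ := by nlinarith

lemma LFunctionTrivChar_upper (N : ℕ) [NeZero N] :
    ∃ K : ℝ, 1 ≤ K ∧ ∀ x : ℝ, 0 < x → x ≤ 1 → ‖LFunctionTrivChar N (1 + x)‖ ≤ K / x := by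
  have hc : ContinuousOn (fun x : ℝ ↦ LFunctionTrivChar₁ N (1 + x)) (Set.Icc 0 1) :=
    (differentiable_LFunctionTrivChar₁ N).continuous.comp_continuousOn (by fun_prop)
  obtain ⟨K, hK⟩ := isCompact_Icc.exists_bound_of_continuousOn hc
  refine ⟨max K 1, le_max_right _ _, fun x h0 h1 ↦ ?_⟩
  have h := hK x ⟨h0.le, h1⟩
  have hx : (1 + x : ℂ) ≠ 1 := by simpa using h0.ne'
  rw [LFunctionTrivChar₁, Function.update_of_ne hx] at h
  rw [le_div_iff₀ h0]
  rw [add_sub_cancel_left, norm_mul, norm_real, Real.norm_of_nonneg h0.le] at h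
  linarith [le_max_left K 1]

lemma LFunction_lower {N : ℕ} [NeZero N] (χ : DirichletCharacter ℂ N) :
    ∃ c : ℝ, 0 < c ∧ ∀ s : ℂ, 1 < s.re → s.re ≤ 2 → 1 ≤ |s.im| →
      c ≤ ‖LFunction χ s‖ * (|s.im| ^ (1 / 16 : ℝ)) ^ 4 := by
  obtain ⟨M₁, hM₁, hM₁'⟩ := iteratedDeriv_LFunction_growth χ
  obtain ⟨M₂, hM₂, hM₂'⟩ := iteratedDeriv_LFunction_growth (χ ^ 2)
  obtain ⟨K, hK, hK'⟩ := LFunctionTrivChar_upper N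
  set M := max M₁ M₂ with hM
  have hM1 : 1 ≤ M := hM₁.trans (le_max_left _ _)
  set A := 2 * K ^ 3 * M with hA
  have hA1 : 1 ≤ A := by
    have : 1 ≤ K ^ 3 := one_le_pow₀ hK
    nlinarith
  refine ⟨1 / (16 * M ^ 3 * A), by positivity, fun s h1 h2 h3 ↦ ?_⟩
  set t := s.im with ht
  set T := |t| ^ (1 / 16 : ℝ) with hT
  have hT1 : 1 ≤ T := Real.one_le_rpow h3 (by norm_num)
  -- the 3-4-1 inequality
  have h341 : ∀ x : ℝ, 0 < x → x ≤ 1 → x ^ 3 ≤ A * T * ‖LFunction χ (1 + x + I * t)‖ ^ 4 := by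
    intro x hx0 hx1
    have h := norm_LFunction_product_ge_one χ hx0 t
    rw [norm_mul, norm_mul, norm_pow, norm_pow] at h
    have b1 := hK' x hx0 hx1
    have b2 : ‖LFunction (χ ^ 2) (1 + x + 2 * I * t)‖ ≤ 2 * M * T := by
      have e : (1 + x + 2 * I * t : ℂ).im = 2 * t := by simp
      have := hM₂' 0 (by norm_num) (1 + x + 2 * I * t) (by simp; linarith) (by simp; linarith)
        (by rw [e, abs_mul, abs_two]; linarith)
      rw [iteratedDeriv_zero, e] at this
      refine this.trans ?_
      rw [abs_mul, abs_two, Real.mul_rpow (by norm_num) (abs_nonneg _), ← hT]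
      have h2 : (2 : ℝ) ^ (1 / 16 : ℝ) ≤ 2 := by
        calc (2 : ℝ) ^ (1 / 16 : ℝ) ≤ 2 ^ (1 : ℝ) :=
              Real.rpow_le_rpow_of_exponent_le (by norm_num) (by norm_num)
          _ = 2 := Real.rpow_one _
      have h3 : M₂ ≤ M := le_max_right _ _
      calc M₂ * (2 ^ (1 / 16 : ℝ) * T) ≤ M * (2 * T) := by gcongr
        _ = _ := by ring
    have h4 : 1 ≤ (K / x) ^ 3 * ‖LFunction χ (1 + x + I * t)‖ ^ 4 * (2 * M * T) := by
      refine h.le.trans ?_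
      gcongr
    calc x ^ 3 = x ^ 3 * 1 := by ring
      _ ≤ x ^ 3 * ((K / x) ^ 3 * ‖LFunction χ (1 + x + I * t)‖ ^ 4 * (2 * M * T)) := by gcongr
      _ = _ := by rw [hA]; field_simp
  set x₀ := 1 / (16 * M ^ 4 * A * T ^ 5) with hx₀
  have hx₀0 : 0 < x₀ := by positivity
  have hx₀1 : x₀ ≤ 1 := by
    rw [hx₀, div_le_one (by positivity)]
    have a1 : 1 ≤ M ^ 4 := one_le_pow₀ hM1
    have a2 : 1 ≤ T ^ 5 := one_le_pow₀ hT1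
    have a3 : 1 ≤ M ^ 4 * A := one_le_mul_of_one_le_of_one_le a1 hA1
    have a4 : 1 ≤ M ^ 4 * A * T ^ 5 := one_le_mul_of_one_le_of_one_le a3 a2
    nlinarith
  have hbig : ∀ x : ℝ, x₀ ≤ x → x ≤ 1 → 2 * M * T * x₀ ≤ ‖LFunction χ (1 + x + I * t)‖ := by
    intro x hx hx1
    have h := h341 x (hx₀0.trans_le hx) hx1
    have h5 : x₀ ^ 3 ≤ x ^ 3 := by gcongr
    refine le_of_pow_le_pow_left₀ (n := 4) (by norm_num) (norm_nonneg _) ?_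
    have e : A * T * (2 * M * T * x₀) ^ 4 = x₀ ^ 3 := by
      rw [hx₀]; field_simp; norm_num
    have : A * T * (2 * M * T * x₀) ^ 4 ≤ A * T * ‖LFunction χ (1 + x + I * t)‖ ^ 4 := by
      rw [e]; linarith
    exact le_of_mul_le_mul_left this (by positivity)
  have hfin : M * T * x₀ ≤ ‖LFunction χ s‖ := by
    have es : (1 + (s.re - 1 : ℝ) + I * t : ℂ) = s := by
      apply Complex.ext <;> simp [ht]
    have hp : 0 < M * T * x₀ := by positivity
    rcases le_total x₀ (s.re - 1) with h | h
    · have := hbig (s.re - 1) h (by linarith)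
      rw [es] at this
      linarith
    · have hb := hbig x₀ le_rfl hx₀1
      have hconv : Convex ℝ ({z : ℂ | 1 ≤ z.re} ∩ {z | z.re ≤ 2} ∩ {z | z.im = t}) :=
        ((convex_halfSpace_re_ge 1).inter (convex_halfSpace_re_le 2)).inter
          (convex_hyperplane (f := fun z : ℂ ↦ z.im) ⟨fun x y ↦ by simp, fun c x ↦ by simp⟩ t)
      have hne : ∀ z : ℂ, z.im = t → z ≠ 1 := by
        rintro z hz rfl
        rw [← hz] at h3
        norm_num at h3
      have := hconv.norm_image_sub_le_of_norm_deriv_le (f := LFunction χ) (C := M * T)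
        (x := s) (y := (1 + x₀ + I * t : ℂ))
        (fun z hz ↦ differentiableAt_LFunction χ z (.inl (hne z hz.2)))
        (fun z hz ↦ by
          have hz3 : z.im = t := hz.2
          have := hM₁' 1 (by norm_num) z hz.1.1 hz.1.2 (by rw [hz3]; exact h3)
          rw [iteratedDeriv_one, hz3] at this
          refine this.trans ?_
          have : M₁ ≤ M := le_max_left _ _
          gcongr) ⟨⟨h1.le, h2⟩, rfl⟩ ⟨⟨by simp; linarith, by simp; linarith⟩, by simp⟩
      have e2 : ‖(1 + x₀ + I * t : ℂ) - s‖ ≤ x₀ := by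
        have : (1 + x₀ + I * t : ℂ) - s = ((1 + x₀ - s.re : ℝ) : ℂ) := by
          apply Complex.ext <;> simp [ht]
        rw [this, norm_real, Real.norm_eq_abs, abs_le]
        constructor <;> linarith
      have e3 : M * T * ‖(1 + x₀ + I * t : ℂ) - s‖ ≤ M * T * x₀ := by gcongr
      have e4 := norm_sub_norm_le (LFunction χ (1 + x₀ + I * t : ℂ)) (LFunction χ s)
      linarith
  calc 1 / (16 * M ^ 3 * A) = M * T * x₀ * T ^ 4 := by rw [hx₀]; field_simp
    _ ≤ _ := by gcongr

/-- The transform `(-L'/L(1 + z, χ) - r/z - c)/z`. -/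
noncomputable def logDerivTransform {N : ℕ} [NeZero N] (χ : DirichletCharacter ℂ N)
    (r c z : ℂ) : ℂ :=
  (-(deriv (LFunction χ) (1 + z) / LFunction χ (1 + z)) - r / z - c) / z

lemma hasDerivAt_iteratedDeriv_LFunction {N : ℕ} [NeZero N] (χ : DirichletCharacter ℂ N) (j : ℕ)
    {z : ℂ} (hz : z ≠ 0) :
    HasDerivAt (fun z ↦ iteratedDeriv j (LFunction χ) (1 + z))
      (iteratedDeriv (j + 1) (LFunction χ) (1 + z)) z := by
  have hz1 : 1 + z ≠ 1 := by simpa using hz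
  have hopen : IsOpen ({1}ᶜ : Set ℂ) := isOpen_compl_singleton
  have hd : DifferentiableOn ℂ (LFunction χ) {1}ᶜ := fun w hw ↦
    (differentiableAt_LFunction χ w (.inl hw)).differentiableWithinAt
  have ha : AnalyticAt ℂ (LFunction χ) (1 + z) := hd.analyticAt (hopen.mem_nhds hz1)
  have h1 := (ha.iterated_deriv j).differentiableAt.hasDerivAt
  rw [← iteratedDeriv_eq_iterate, ← iteratedDeriv_succ] at h1
  exact h1.comp_const_add 1 z

lemma logDerivTransform_bound_far {N : ℕ} [NeZero N] (χ : DirichletCharacter ℂ N) (r c : ℂ) :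
    ∃ C : ℝ, ∀ z : ℂ, 0 < z.re → z.re < 1 → 1 < |z.im| →
      ‖logDerivTransform χ r c z‖ ≤ C ∧ ‖deriv (logDerivTransform χ r c) z‖ ≤ C ∧
      ‖deriv (deriv (logDerivTransform χ r c)) z‖ ≤ C := by
  obtain ⟨M, hM, hM'⟩ := iteratedDeriv_LFunction_growth χ
  obtain ⟨b, hb, hb'⟩ := LFunction_lower χ
  let l : ℕ → ℂ → ℂ := fun j z ↦ iteratedDeriv j (LFunction χ) (1 + z)
  have hl : ∀ j z, z ≠ 0 → HasDerivAt (l j) (l (j + 1) z) z := fun j z hz ↦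
    hasDerivAt_iteratedDeriv_LFunction χ j hz
  let P0 : ℂ → ℂ := fun z ↦ -(l 1 z / l 0 z) - r / z - c
  let P1 : ℂ → ℂ := fun z ↦ -(l 2 z / l 0 z) + (l 1 z / l 0 z) ^ 2 + r / z ^ 2
  let P2 : ℂ → ℂ := fun z ↦ -(l 3 z / l 0 z) + 3 * (l 1 z / l 0 z) * (l 2 z / l 0 z)
    - 2 * (l 1 z / l 0 z) ^ 3 - 2 * r / z ^ 3
  let U : Set ℂ := {z | 0 < z.re} ∩ {z | z.re < 1} ∩ {z | 1 < |z.im|}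
  have hU : IsOpen U := ((isOpen_lt continuous_const continuous_re).inter
    (isOpen_lt continuous_re continuous_const)).inter
      (isOpen_lt continuous_const (continuous_abs.comp continuous_im))
  have hU0 : ∀ z ∈ U, z ≠ 0 := by
    rintro z ⟨⟨hz, -⟩, -⟩ rfl
    simp at hz
  have hT1 : ∀ z ∈ U, 1 ≤ |z.im| ^ (1 / 16 : ℝ) := fun z hz ↦
    Real.one_le_rpow (le_of_lt hz.2) (by norm_num)
  have hlow : ∀ z ∈ U, b ≤ ‖l 0 z‖ * (|z.im| ^ (1 / 16 : ℝ)) ^ 4 := by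
    intro z hz
    have h1 : 0 < z.re := hz.1.1
    have h2 : z.re < 1 := hz.1.2
    have := hb' (1 + z) (by simpa using h1) (by simp; linarith) (by simpa using le_of_lt hz.2)
    simpa [l] using this
  have hl0 : ∀ z ∈ U, l 0 z ≠ 0 := by
    intro z hz h
    have := hlow z hz
    rw [h, norm_zero, zero_mul] at this
    linarith
  have hq : ∀ j ≤ 3, ∀ z ∈ U, ‖l j z / l 0 z‖ ≤ (M / b) * (|z.im| ^ (1 / 16 : ℝ)) ^ 5 := by
    intro j hj z hz
    have h1 : 0 < z.re := hz.1.1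
    have h2 : z.re < 1 := hz.1.2
    have hu := hM' j hj (1 + z) (by simp; linarith) (by simp; linarith)
      (by simpa using le_of_lt hz.2)
    have hlo := hlow z hz
    simp only [add_im, one_im, zero_add] at hu
    have hpos : 0 < ‖l 0 z‖ := norm_pos_iff.mpr (hl0 z hz)
    have hT := hT1 z hz
    rw [norm_div, div_le_iff₀ hpos]
    calc ‖l j z‖ ≤ M * |z.im| ^ (1 / 16 : ℝ) := hu
      _ = (M / b) * |z.im| ^ (1 / 16 : ℝ) * b := by field_simp
      _ ≤ (M / b) * |z.im| ^ (1 / 16 : ℝ) * (‖l 0 z‖ * (|z.im| ^ (1 / 16 : ℝ)) ^ 4) := by gcongr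
      _ = _ := by ring
  have hH0 : ∀ z, logDerivTransform χ r c z = P0 z / z := by
    intro z
    simp [logDerivTransform, P0, l]
  have hP0d : ∀ z ∈ U, HasDerivAt P0 (P1 z) z := by
    intro z hz
    have hz0 := hU0 z hz
    have h := ((((hl 1 z hz0).div (hl 0 z hz0) (hl0 z hz)).neg).sub
      ((hasDerivAt_const z r).div (hasDerivAt_id z) hz0)).sub_const c
    refine h.congr_deriv ?_
    have := hl0 z hz
    simp only [P1, id]
    field_simp
    ring
  have hP1d : ∀ z ∈ U, HasDerivAt P1 (P2 z) z := by
    intro z hz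
    have hz0 := hU0 z hz
    have h := ((((hl 2 z hz0).div (hl 0 z hz0) (hl0 z hz)).neg).add
      (((hl 1 z hz0).div (hl 0 z hz0) (hl0 z hz)).pow 2)).add
      ((hasDerivAt_const z r).div ((hasDerivAt_id z).pow 2) (pow_ne_zero 2 hz0))
    refine h.congr_deriv ?_
    have := hl0 z hz
    simp only [P2, id, Pi.div_apply, Pi.pow_apply, show 2 - 1 = 1 from rfl, pow_one, zero_add,
      Nat.reduceAdd, Nat.cast_ofNat]
    field_simp
    ring
  have hd1 : ∀ z ∈ U, HasDerivAt (logDerivTransform χ r c) (P1 z / z - P0 z / z ^ 2) z := by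
    intro z hz
    have hz0 := hU0 z hz
    rw [show logDerivTransform χ r c = fun z ↦ P0 z / z from funext hH0]
    refine ((hP0d z hz).div (hasDerivAt_id z) hz0).congr_deriv ?_
    simp only [id]
    field_simp
  have hd2 : ∀ z ∈ U, HasDerivAt (deriv (logDerivTransform χ r c))
      (P2 z / z - 2 * P1 z / z ^ 2 + 2 * P0 z / z ^ 3) z := by
    intro z hz
    have hz0 := hU0 z hz
    have e : deriv (logDerivTransform χ r c) =ᶠ[nhds z] fun z ↦ P1 z / z - P0 z / z ^ 2 := by
      filter_upwards [hU.mem_nhds hz] with w hw using (hd1 w hw).deriv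
    refine HasDerivAt.congr_of_eventuallyEq ?_ e
    refine (((hP1d z hz).div (hasDerivAt_id z) hz0).sub
      ((hP0d z hz).div ((hasDerivAt_id z).pow 2) (pow_ne_zero 2 hz0))).congr_deriv ?_
    simp only [id, Pi.pow_apply]
    field_simp
    ring
  set D := M / b + 1 with hD
  have hMb : 0 ≤ M / b := by positivity
  have hD1 : 1 ≤ D := by linarith
  set K := 6 * D ^ 3 + 2 * ‖r‖ + ‖c‖ with hK
  have hPb : ∀ z ∈ U, ‖P0 z‖ ≤ K * ‖z‖ ∧ ‖P1 z‖ ≤ K * ‖z‖ ∧ ‖P2 z‖ ≤ K * ‖z‖ ∧ 1 ≤ ‖z‖ := by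
    intro z hz
    set T := |z.im| ^ (1 / 16 : ℝ) with hT
    have hT1' := hT1 z hz
    have hTz : T ^ 15 ≤ ‖z‖ := by
      have : T ^ 16 = |z.im| := by
        rw [hT, ← Real.rpow_natCast, ← Real.rpow_mul (abs_nonneg _)]
        norm_num
      calc T ^ 15 ≤ T ^ 16 := pow_le_pow_right₀ hT1' (by norm_num)
        _ = |z.im| := this
        _ ≤ _ := abs_im_le_norm z
    have hz1 : 1 ≤ ‖z‖ := (one_le_pow₀ hT1').trans hTz
    have q : ∀ j ≤ 3, ‖l j z / l 0 z‖ ≤ D * T ^ 5 := fun j hj ↦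
      (hq j hj z hz).trans (by gcongr; linarith)
    have hDT : 1 ≤ D * T ^ 5 := one_le_mul_of_one_le_of_one_le hD1 (one_le_pow₀ hT1')
    have q1 := q 1 (by norm_num)
    have q2 := q 2 (by norm_num)
    have q3 := q 3 (by norm_num)
    set X := D * T ^ 5 with hX
    have hX3 : X ^ 3 ≤ D ^ 3 * ‖z‖ := by
      rw [hX, mul_pow, ← pow_mul]; gcongr
    have hX12 : X ≤ X ^ 3 := le_self_pow₀ hDT (by norm_num)
    have hX23 : X ^ 2 ≤ X ^ 3 := pow_le_pow_right₀ hDT (by norm_num)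
    have rb : ∀ k : ℕ, ‖r / z ^ k‖ ≤ ‖r‖ := by
      intro k
      rw [norm_div, norm_pow]
      exact div_le_self (norm_nonneg _) (one_le_pow₀ hz1)
    have rz : ‖r‖ ≤ ‖r‖ * ‖z‖ := le_mul_of_one_le_right (norm_nonneg _) hz1
    have cz : ‖c‖ ≤ ‖c‖ * ‖z‖ := le_mul_of_one_le_right (norm_nonneg _) hz1
    have r0 := norm_nonneg r
    have c0 := norm_nonneg c
    have rz0 := mul_nonneg r0 (norm_nonneg z)
    have cz0 := mul_nonneg c0 (norm_nonneg z)
    refine ⟨?_, ?_, ?_, hz1⟩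
    · have h1 := rb 1
      rw [pow_one] at h1
      calc ‖P0 z‖ ≤ ‖l 1 z / l 0 z‖ + ‖r / z‖ + ‖c‖ := by
            refine (norm_sub_le _ _).trans (add_le_add_left ((norm_sub_le _ _).trans ?_) _)
            rw [norm_neg]
        _ ≤ _ := by rw [hK]; nlinarith
    · have h1 := rb 2
      calc ‖P1 z‖ ≤ ‖l 2 z / l 0 z‖ + ‖l 1 z / l 0 z‖ ^ 2 + ‖r / z ^ 2‖ := by
            refine norm_add₃_le.trans ?_
            rw [norm_neg, norm_pow]
        _ ≤ X + X ^ 2 + ‖r‖ := by gcongr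
        _ ≤ _ := by rw [hK]; nlinarith
    · have h1 := rb 3
      calc ‖P2 z‖ ≤ ‖l 3 z / l 0 z‖ + 3 * ‖l 1 z / l 0 z‖ * ‖l 2 z / l 0 z‖
            + 2 * ‖l 1 z / l 0 z‖ ^ 3 + 2 * ‖r / z ^ 3‖ := by
            have e : P2 z = -(l 3 z / l 0 z) + 3 * (l 1 z / l 0 z) * (l 2 z / l 0 z)
              - 2 * (l 1 z / l 0 z) ^ 3 - 2 * (r / z ^ 3) := by simp only [P2]; ring
            rw [e]
            refine (norm_sub_le _ _).trans (add_le_add ((norm_sub_le _ _).trans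
              (add_le_add ((norm_add_le _ _).trans ?_) ?_)) ?_)
            · rw [norm_neg, norm_mul, norm_mul]; norm_num
            · rw [norm_mul, norm_pow]; norm_num
            · rw [norm_mul]; norm_num
        _ ≤ X + 3 * X * X + 2 * X ^ 3 + 2 * ‖r‖ := by gcongr
        _ ≤ _ := by rw [hK]; nlinarith
  have hK0 : 0 ≤ K := by positivity
  have hdiv : ∀ z ∈ U, ∀ w : ℂ, ‖w‖ ≤ K * ‖z‖ → ∀ k : ℕ, ‖w / z ^ (k + 1)‖ ≤ K := by
    intro z hz w hw k
    have hz1 := (hPb z hz).2.2.2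
    rw [norm_div, norm_pow, div_le_iff₀ (by positivity)]
    refine hw.trans ?_
    gcongr
    exact le_self_pow₀ hz1 (by omega)
  refine ⟨5 * K, fun z h1 h2 h3 ↦ ?_⟩
  have hz : z ∈ U := ⟨⟨h1, h2⟩, h3⟩
  obtain ⟨b0, b1, b2, -⟩ := hPb z hz
  refine ⟨?_, ?_, ?_⟩
  · rw [hH0]
    have := hdiv z hz _ b0 0
    simp only [zero_add, pow_one] at this
    linarith
  · rw [(hd1 z hz).deriv]
    have a1 := hdiv z hz _ b1 0
    have a2 : ‖P0 z / z ^ 2‖ ≤ K := hdiv z hz _ b0 1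
    simp only [zero_add, pow_one] at a1
    refine (norm_sub_le _ _).trans ?_
    linarith
  · rw [(hd2 z hz).deriv]
    have a1 := hdiv z hz _ b2 0
    have a2 := hdiv z hz _ b1 1
    have a3 := hdiv z hz _ b0 2
    simp only [zero_add, pow_one] at a1
    have e : P2 z / z - 2 * P1 z / z ^ 2 + 2 * P0 z / z ^ 3 =
      P2 z / z - 2 * (P1 z / z ^ (1 + 1)) + 2 * (P0 z / z ^ (2 + 1)) := by ring
    rw [e]
    refine (norm_add_le _ _).trans ((add_le_add_left (norm_sub_le _ _) _).trans ?_)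
    rw [norm_mul, norm_mul, norm_ofNat]
    linarith

lemma logDerivTransform_bound {N : ℕ} [NeZero N] (χ : DirichletCharacter ℂ N) (r : ℂ) (f : ℂ → ℂ)
    (hf : Differentiable ℂ f) (hf0 : ∀ s : ℂ, 1 ≤ s.re → f s ≠ 0)
    (hfL : ∀ s : ℂ, 1 < s.re → -(deriv (LFunction χ) s / LFunction χ s) - r / (s - 1) =
      -(deriv f s / f s)) :
    DifferentiableOn ℂ (logDerivTransform χ r (-(deriv f 1 / f 1))) {z | 0 < z.re} ∧
    ∃ C : ℝ, ∀ z : ℂ, 0 < z.re → z.re < 1 →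
      ‖logDerivTransform χ r (-(deriv f 1 / f 1)) z‖ ≤ C ∧
      ‖deriv (logDerivTransform χ r (-(deriv f 1 / f 1))) z‖ ≤ C ∧
      ‖deriv (deriv (logDerivTransform χ r (-(deriv f 1 / f 1)))) z‖ ≤ C := by
  set c := -(deriv f 1 / f 1) with hc
  let g : ℂ → ℂ := fun z ↦ -(deriv f (1 + z) / f (1 + z))
  let U : Set ℂ := {z | f (1 + z) ≠ 0}
  have hU : IsOpen U := isOpen_ne_fun (hf.continuous.comp (by fun_prop)) continuous_const
  have h0 : ∀ z : ℂ, 0 ≤ z.re → z ∈ U := fun z hz ↦ hf0 _ (by simpa using hz)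
  have hfd : Differentiable ℂ (deriv f) := by
    have := hf.differentiableOn (s := Set.univ)
    exact differentiableOn_univ.mp (this.deriv isOpen_univ)
  have hg : DifferentiableOn ℂ g U := by
    intro z hz
    refine DifferentiableAt.differentiableWithinAt ?_
    have h1 : DifferentiableAt ℂ (fun z ↦ deriv f (1 + z)) z :=
      hfd.differentiableAt.comp z (by fun_prop)
    have h2 : DifferentiableAt ℂ (fun z ↦ f (1 + z)) z :=
      hf.differentiableAt.comp z (by fun_prop)
    exact (h1.div h2 hz).neg
  have hG : DifferentiableOn ℂ (dslope g 0) U :=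
    (differentiableOn_dslope (hU.mem_nhds (h0 0 (by simp)))).mpr hg
  have hV : IsOpen {z : ℂ | 0 < z.re} := isOpen_lt continuous_const continuous_re
  have hGH : Set.EqOn (logDerivTransform χ r c) (dslope g 0) {z | 0 < z.re} := by
    intro z hz
    have hz' : 0 < z.re := hz
    have hz0 : z ≠ 0 := by rintro rfl; simp at hz'
    rw [dslope_of_ne _ hz0, slope_def_field]
    have := hfL (1 + z) (by simpa using hz')
    rw [add_sub_cancel_left] at this
    rw [logDerivTransform, this]
    simp [g, hc]
  have hGH1 : Set.EqOn (deriv (logDerivTransform χ r c)) (deriv (dslope g 0)) {z | 0 < z.re} :=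
    hGH.deriv hV
  have hGH2 := hGH1.deriv hV
  refine ⟨(hG.mono fun z hz ↦ h0 z (le_of_lt hz)).congr hGH, ?_⟩
  obtain ⟨C₁, hC₁⟩ := logDerivTransform_bound_far χ r c
  have hK : IsCompact (Set.Icc 0 1 ×ℂ Set.Icc (-1) 1) := isCompact_Icc.reProdIm isCompact_Icc
  have hKU : (Set.Icc 0 1 ×ℂ Set.Icc (-1) 1) ⊆ U := fun z hz ↦ h0 z hz.1.1
  have hG1 := hG.deriv hU
  have hG2 := hG1.deriv hU
  obtain ⟨B0, hB0⟩ := hK.exists_bound_of_continuousOn (hG.continuousOn.mono hKU)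
  obtain ⟨B1, hB1⟩ := hK.exists_bound_of_continuousOn (hG1.continuousOn.mono hKU)
  obtain ⟨B2, hB2⟩ := hK.exists_bound_of_continuousOn (hG2.continuousOn.mono hKU)
  refine ⟨max C₁ (max B0 (max B1 B2)), fun z hz0 hz1 ↦ ?_⟩
  rcases lt_or_ge 1 |z.im| with h | h
  · obtain ⟨a, b, d⟩ := hC₁ z hz0 hz1 h
    exact ⟨a.trans (le_max_left _ _), b.trans (le_max_left _ _), d.trans (le_max_left _ _)⟩
  · have hz : z ∈ Set.Icc 0 1 ×ℂ Set.Icc (-1) 1 := ⟨⟨hz0.le, hz1.le⟩, abs_le.mp h⟩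
    rw [hGH hz0, hGH1 hz0, hGH2 hz0]
    refine ⟨(hB0 z hz).trans ?_, (hB1 z hz).trans ?_, (hB2 z hz).trans ?_⟩ <;> simp

/-- The residue at `1` of the logarithmic derivative of `L(s, χ)`, up to sign. -/
noncomputable def poleOrder {N : ℕ} (χ : DirichletCharacter ℂ N) : ℝ :=
  open Classical in if χ = 1 then 1 else 0

lemma exists_logDerivTransform_bound {N : ℕ} [NeZero N] (χ : DirichletCharacter ℂ N) :
    ∃ c : ℂ, (χ ≠ 1 → c = -(deriv (LFunction χ) 1 / LFunction χ 1)) ∧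
    DifferentiableOn ℂ (logDerivTransform χ (poleOrder χ) c) {z | 0 < z.re} ∧
    ∃ C : ℝ, ∀ z : ℂ, 0 < z.re → z.re < 1 →
      ‖logDerivTransform χ (poleOrder χ) c z‖ ≤ C ∧
      ‖deriv (logDerivTransform χ (poleOrder χ) c) z‖ ≤ C ∧
      ‖deriv (deriv (logDerivTransform χ (poleOrder χ) c)) z‖ ≤ C := by
  by_cases hχ : χ = 1
  · subst hχ
    refine ⟨_, fun h ↦ (h rfl).elim, logDerivTransform_bound 1 (poleOrder 1)
      (LFunctionTrivChar₁ N) (differentiable_LFunctionTrivChar₁ N) (fun s hs ↦ ?_) (fun s hs ↦ ?_)⟩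
    · rcases eq_or_ne s 1 with rfl | h
      · exact LFunctionTrivChar₁_apply_one_ne_zero N
      · rw [LFunctionTrivChar₁, Function.update_of_ne h]
        exact mul_ne_zero (sub_ne_zero_of_ne h) (LFunction_ne_zero_of_one_le_re _ (.inr h) hs)
    · have h : s ≠ 1 := by rintro rfl; simp at hs
      have hL : LFunctionTrivChar N s ≠ 0 := LFunction_ne_zero_of_one_le_re _ (.inr h) hs.le
      have hs1 := sub_ne_zero_of_ne h
      rw [deriv_LFunctionTrivChar₁_apply_of_ne_one _ h, LFunctionTrivChar₁, Function.update_of_ne h]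
      change -(deriv (LFunctionTrivChar N) s / LFunctionTrivChar N s) - _ = _
      simp only [poleOrder, if_true]
      push_cast
      field_simp
      ring
  · refine ⟨_, fun _ ↦ rfl, logDerivTransform_bound χ (poleOrder χ) (LFunction χ)
      (differentiable_LFunction hχ)
      (fun s hs ↦ LFunction_ne_zero_of_one_le_re _ (.inl hχ) hs) (fun s hs ↦ ?_)⟩
    simp [poleOrder, hχ]

section Smoothing

open MeasureTheory
open scoped FourierTransform SchwartzMap

lemma norm_fourier_schwartz_mul_le (k : 𝓢(ℝ, ℂ)) :
    ∃ A : ℝ, 0 ≤ A ∧ ∀ (G G₁ G₂ : ℝ → ℂ) (B : ℝ), (∀ x, HasDerivAt G (G₁ x) x) →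
      (∀ x, HasDerivAt G₁ (G₂ x) x) → Continuous G₂ →
      (∀ x, ‖G x‖ ≤ B) → (∀ x, ‖G₁ x‖ ≤ B) → (∀ x, ‖G₂ x‖ ≤ B) →
      ∀ x : ℝ, x ^ 2 * ‖𝓕 (fun ξ ↦ k ξ * G ξ) x‖ ≤ A * B := by
  let k₁ : 𝓢(ℝ, ℂ) := SchwartzMap.derivCLM ℂ ℂ k
  let k₂ : 𝓢(ℝ, ℂ) := SchwartzMap.derivCLM ℂ ℂ k₁
  have hk : ∀ x, HasDerivAt k (k₁ x) x := fun x ↦ k.hasDerivAt x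
  have hk₁ : ∀ x, HasDerivAt k₁ (k₂ x) x := fun x ↦ k₁.hasDerivAt x
  refine ⟨∫ x, (‖k₂ x‖ + 2 * ‖k₁ x‖ + ‖k x‖), integral_nonneg fun x ↦ by positivity, ?_⟩
  intro G G₁ G₂ B hG hG₁ hc b b₁ b₂ x
  have cG : Continuous G := continuous_iff_continuousAt.mpr fun x ↦ (hG x).continuousAt
  have cG₁ : Continuous G₁ := continuous_iff_continuousAt.mpr fun x ↦ (hG₁ x).continuousAt
  let Φ : ℝ → ℂ := fun ξ ↦ k ξ * G ξ
  let Φ₁ : ℝ → ℂ := fun ξ ↦ k₁ ξ * G ξ + k ξ * G₁ ξ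
  let Φ₂ : ℝ → ℂ := fun ξ ↦ k₂ ξ * G ξ + 2 * (k₁ ξ * G₁ ξ) + k ξ * G₂ ξ
  have hΦ : ∀ x, HasDerivAt Φ (Φ₁ x) x := fun x ↦ (hk x).mul (hG x)
  have hΦ₁ : ∀ x, HasDerivAt Φ₁ (Φ₂ x) x := fun x ↦
    (((hk₁ x).mul (hG x)).add ((hk x).mul (hG₁ x))).congr_deriv (by simp only [Φ₂]; ring)
  have d1 : deriv Φ = Φ₁ := funext fun x ↦ (hΦ x).deriv
  have d2 : deriv Φ₁ = Φ₂ := funext fun x ↦ (hΦ₁ x).deriv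
  have cΦ₂ : Continuous Φ₂ := by
    have := k.continuous
    have := k₁.continuous
    have := k₂.continuous
    fun_prop
  have i1 : iteratedDeriv 1 Φ = Φ₁ := by rw [iteratedDeriv_one, d1]
  have i2 : iteratedDeriv 2 Φ = Φ₂ := by rw [iteratedDeriv_succ, i1, d2]
  have hcd : ContDiff ℝ (2 : ℕ) Φ := by
    rw [contDiff_nat_iff_iteratedDeriv]
    constructor
    · intro m hm
      interval_cases m
      · rw [iteratedDeriv_zero]; exact continuous_iff_continuousAt.mpr fun x ↦ (hΦ x).continuousAt
      · rw [i1]; exact continuous_iff_continuousAt.mpr fun x ↦ (hΦ₁ x).continuousAt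
      · rwa [i2]
    · intro m hm
      interval_cases m
      · rw [iteratedDeriv_zero]; exact fun x ↦ (hΦ x).differentiableAt
      · rw [i1]; exact fun x ↦ (hΦ₁ x).differentiableAt
  have int : ∀ (l : 𝓢(ℝ, ℂ)) (g : ℝ → ℂ), Continuous g → (∀ x, ‖g x‖ ≤ B) →
      Integrable (fun x ↦ l x * g x) := fun l g hg hb ↦
    l.integrable.mul_bdd hg.aestronglyMeasurable (.of_forall hb)
  have hInt2 : Integrable Φ₂ :=
    ((int k₂ G cG b).add ((int k₁ G₁ cG₁ b₁).const_mul 2)).add (int k G₂ hc b₂)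
  have hInt : ∀ n : ℕ, (n : ℕ∞) ≤ (2 : ℕ) → Integrable (iteratedDeriv n Φ) := by
    intro n hn
    have hn : n ≤ 2 := by exact_mod_cast hn
    interval_cases n
    · rw [iteratedDeriv_zero]; exact int k G cG b
    · rw [i1]; exact (int k₁ G cG b).add (int k G₁ cG₁ b₁)
    · rwa [i2]
  have key := congrFun (Real.fourier_iteratedDeriv (N := ((2 : ℕ) : ℕ∞)) (n := 2)
    (by exact_mod_cast hcd) hInt le_rfl) x
  rw [i2] at key
  have hn : ‖𝓕 Φ₂ x‖ ≤ ∫ v, ‖Φ₂ v‖ := VectorFourier.norm_fourierIntegral_le_integral_norm _ _ _ _ _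
  have hle : ∫ v, ‖Φ₂ v‖ ≤ (∫ x, (‖k₂ x‖ + 2 * ‖k₁ x‖ + ‖k x‖)) * B := by
    rw [← integral_mul_const]
    refine integral_mono hInt2.norm ?_ fun v ↦ ?_
    · exact ((k₂.integrable.norm.add (k₁.integrable.norm.const_mul 2)).add
        k.integrable.norm).mul_const B
    · have h1 : ‖k₂ v * G v‖ ≤ ‖k₂ v‖ * B := by rw [norm_mul]; gcongr; exact b v
      have h2 : ‖2 * (k₁ v * G₁ v)‖ ≤ 2 * (‖k₁ v‖ * B) := by
        rw [norm_mul, norm_mul, norm_ofNat]; gcongr; exact b₁ v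
      have h3 : ‖k v * G₂ v‖ ≤ ‖k v‖ * B := by rw [norm_mul]; gcongr; exact b₂ v
      have := norm_add₃_le (a := k₂ v * G v) (b := 2 * (k₁ v * G₁ v)) (c := k v * G₂ v)
      simp only [Φ₂]
      linarith
  refine le_trans ?_ (hn.trans hle)
  rw [key, norm_smul, norm_pow, norm_mul, norm_mul, norm_mul, norm_I, norm_real, norm_real,
    mul_pow, Real.norm_eq_abs, Real.norm_eq_abs, norm_ofNat, sq_abs]
  have hpi : 1 ≤ (2 * |Real.pi| * 1) ^ 2 := by
    rw [abs_of_pos Real.pi_pos]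
    exact one_le_pow₀ (by linarith [Real.pi_gt_three])
  calc x ^ 2 * ‖𝓕 Φ x‖ = 1 * x ^ 2 * ‖𝓕 Φ x‖ := by ring
    _ ≤ _ := by gcongr

lemma fourier_comp_affine (F : ℝ → ℂ) {u h : ℝ} (hh : 0 < h) (ξ : ℝ) :
    𝓕 (fun w ↦ F (u + h * w)) ξ =
      (h : ℂ)⁻¹ * (cexp (2 * Real.pi * I * (ξ * u / h)) *
        ∫ v, F v * cexp (-(2 * Real.pi * I * (ξ / h) * v))) := by
  let g : ℝ → ℂ := fun v ↦ F v * cexp (-(2 * Real.pi * I * (ξ / h) * (v - u)))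
  have hh' : (h : ℂ) ≠ 0 := by exact_mod_cast hh.ne'
  have h1 : 𝓕 (fun w ↦ F (u + h * w)) ξ = ∫ w, g (u + h * w) := by
    rw [Real.fourier_real_eq_integral_exp_smul]
    refine integral_congr_ae (.of_forall fun w ↦ ?_)
    simp only [g, smul_eq_mul]
    rw [mul_comm]
    congr 2
    push_cast
    field_simp
    ring
  have h2 : ∫ v, g v = cexp (2 * Real.pi * I * (ξ * u / h)) *
      ∫ v, F v * cexp (-(2 * Real.pi * I * (ξ / h) * v)) := by
    rw [← integral_const_mul]
    refine integral_congr_ae (.of_forall fun v ↦ ?_)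
    simp only [g]
    rw [mul_left_comm, ← Complex.exp_add]
    congr 2
    field_simp
    ring
  rw [h1, Measure.integral_comp_mul_left (fun w ↦ g (u + w)) h, integral_add_left_eq_self g u,
    abs_of_pos (inv_pos.mpr hh), real_smul, h2, ofReal_inv]

lemma norm_smoothed_exp_le (K : 𝓢(ℝ, ℂ)) :
    ∃ A : ℝ, 0 ≤ A ∧ ∀ (F : ℝ → ℂ) (E : ℂ → ℂ) (a C : ℝ), Integrable F →
      (∀ z : ℂ, z.re = a → E z = ∫ v, F v * cexp (-((z - a) * v))) →
      DifferentiableOn ℂ E {z | 0 < z.re} → 0 < a →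
      (∀ z : ℂ, z.re = a → ‖E z‖ ≤ C ∧ ‖deriv E z‖ ≤ C ∧ ‖deriv (deriv E) z‖ ≤ C) →
      ∀ u h : ℝ, 0 < h → h ≤ 1 → 0 < u →
        ‖∫ w, F (u + h * w) * K w‖ ≤ A * C / (h * u ^ 2) := by
  let k : 𝓢(ℝ, ℂ) := 𝓕⁻ K
  have hk : 𝓕 (k : ℝ → ℂ) = K := by
    rw [← SchwartzMap.fourier_coe]
    simp [k]
  obtain ⟨A, hA, hA'⟩ := norm_fourier_schwartz_mul_le k
  refine ⟨A * (2 * Real.pi) ^ 2, by positivity, ?_⟩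
  intro F E a C hF hE hd ha hC u h hh hh1 hu
  have hU : IsOpen {z : ℂ | 0 < z.re} := isOpen_lt continuous_const continuous_re
  have hd1 := hd.deriv hU
  have hd2 := hd1.deriv hU
  let ω : ℂ := 2 * Real.pi * I / h
  let p : ℝ → ℂ := fun ξ ↦ a + ω * ξ
  have hp : ∀ ξ, HasDerivAt p ω ξ := fun ξ ↦ by
    have := ((hasDerivAt_id (ξ : ℂ)).const_mul ω).const_add (a : ℂ)
    exact this.comp_ofReal.congr_deriv (mul_one _)
  have hpre : ∀ ξ, (p ξ).re = a := by
    intro ξ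
    have : p ξ = a + (2 * Real.pi / h * ξ : ℝ) * I := by simp [p, ω]; ring
    rw [this]; simp
  have hpU : ∀ ξ, p ξ ∈ {z : ℂ | 0 < z.re} := fun ξ ↦ by
    change 0 < (p ξ).re
    rwa [hpre]
  have hωn : ‖ω‖ = 2 * Real.pi / h := by
    simp [ω, abs_of_pos hh, abs_of_pos Real.pi_pos]
  have hω1 : 1 ≤ ‖ω‖ := by
    rw [hωn, le_div_iff₀ hh]
    linarith [Real.pi_gt_three]
  have hC0 : 0 ≤ C := (norm_nonneg _).trans (hC a (by simp)).1
  have key := hA' (fun ξ ↦ E (p ξ)) (fun ξ ↦ ω * deriv E (p ξ))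
    (fun ξ ↦ ω * (ω * deriv (deriv E) (p ξ))) (C * ‖ω‖ ^ 2)
    (fun ξ ↦ by
      have := ((hd.differentiableAt (hU.mem_nhds (hpU ξ))).hasDerivAt).comp ξ (hp ξ)
      exact this.congr_deriv (mul_comm _ _))
    (fun ξ ↦ by
      have := (((hd1.differentiableAt (hU.mem_nhds (hpU ξ))).hasDerivAt).comp ξ (hp ξ)).const_mul ω
      exact this.congr_deriv (by ring))
    (by
      have : Continuous fun ξ ↦ deriv (deriv E) (p ξ) :=
        hd2.continuousOn.comp_continuous
          (continuous_iff_continuousAt.mpr fun ξ ↦ (hp ξ).continuousAt) hpU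
      fun_prop)
    (fun ξ ↦ (hC _ (hpre ξ)).1.trans (le_mul_of_one_le_right hC0 (one_le_pow₀ hω1)))
    (fun ξ ↦ by
      rw [norm_mul, mul_comm]
      have := (hC _ (hpre ξ)).2.1
      have h2 : ‖ω‖ ≤ ‖ω‖ ^ 2 := le_self_pow₀ hω1 (by norm_num)
      gcongr)
    (fun ξ ↦ by
      rw [norm_mul, norm_mul, ← mul_assoc, mul_comm, ← sq]
      have := (hC _ (hpre ξ)).2.2
      gcongr)
    (-(u / h))
  have hFa : Integrable (fun w ↦ F (u + h * w)) :=
    (hF.comp_add_left u).comp_mul_left' hh.ne'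
  have e1 : ∫ w, F (u + h * w) * K w = ∫ ξ, 𝓕 (fun w ↦ F (u + h * w)) ξ * k ξ := by
    have := VectorFourier.integral_fourierIntegral_smul_eq_flip (L := innerₗ ℝ)
      (μ := volume) (ν := volume) Real.continuous_fourierChar continuous_inner hFa k.integrable
    rw [flip_innerₗ] at this
    simp only [smul_eq_mul] at this
    rw [← hk]
    exact this.symm
  have e2 : ∫ ξ, 𝓕 (fun w ↦ F (u + h * w)) ξ * k ξ =
      (h : ℂ)⁻¹ * 𝓕 (fun ξ ↦ k ξ * E (p ξ)) (-(u / h)) := by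
    rw [Real.fourier_real_eq_integral_exp_smul, ← integral_const_mul]
    refine integral_congr_ae (.of_forall fun ξ ↦ ?_)
    simp only [smul_eq_mul]
    rw [fourier_comp_affine F hh ξ, hE _ (hpre ξ)]
    have a1 : ∀ v : ℝ, cexp (-((p ξ - a) * v)) = cexp (-(2 * Real.pi * I * (ξ / h) * v)) := by
      intro v
      congr 1
      simp only [p, ω]
      ring
    have a2 : cexp (2 * Real.pi * I * (ξ * u / h)) =
        cexp (((-2 * Real.pi * ξ * -(u / h) : ℝ) : ℂ) * I) := by
      congr 1
      push_cast
      ring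
    simp only [a1, a2]
    ring
  rw [e1, e2, norm_mul, norm_inv, norm_real, Real.norm_of_nonneg hh.le]
  rw [hωn] at key
  have hu2 : 0 < (-(u / h)) ^ 2 := by rw [neg_sq]; positivity
  rw [mul_comm, ← le_div_iff₀ hu2] at key
  calc h⁻¹ * ‖𝓕 (fun ξ ↦ k ξ * E (p ξ)) (-(u / h))‖
      ≤ h⁻¹ * (A * (C * (2 * Real.pi / h) ^ 2) / (-(u / h)) ^ 2) := by gcongr
    _ = _ := by field_simp

lemma norm_smoothed_le (K : 𝓢(ℝ, ℂ)) (hK : ∀ w : ℝ, 1 < |w| → K w = 0) :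
    ∃ A : ℝ, 0 ≤ A ∧ ∀ (E : ℝ → ℂ) (H : ℂ → ℂ) (C : ℝ),
      (∀ a : ℝ, 0 < a → IntegrableOn (fun v ↦ E v * cexp (-(a * v))) (Set.Ioi 0)) →
      (∀ z : ℂ, 0 < z.re → H z = ∫ v in Set.Ioi (0 : ℝ), E v * cexp (-(z * v))) →
      DifferentiableOn ℂ H {z | 0 < z.re} →
      (∀ z : ℂ, 0 < z.re → z.re < 1 → ‖H z‖ ≤ C ∧ ‖deriv H z‖ ≤ C ∧ ‖deriv (deriv H) z‖ ≤ C) →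
      ∀ u h : ℝ, 0 < h → h ≤ 1 → h < u →
        ‖∫ w, E (u + h * w) * K w‖ ≤ A * C / (h * u ^ 2) := by
  obtain ⟨A, hA, hA'⟩ := norm_smoothed_exp_le K
  refine ⟨A, hA, fun E H C hInt hH hd hC u h hh hh1 hhu ↦ ?_⟩
  have hu : 0 < u := hh.trans hhu
  let F : ℝ → ℝ → ℂ := fun a ↦ (Set.Ioi (0 : ℝ)).indicator fun v ↦ E v * cexp (-(a * v))
  have hF : ∀ a : ℝ, 0 < a → Integrable (F a) := fun a ha ↦
    (integrable_indicator_iff measurableSet_Ioi).mpr (hInt a ha)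
  have hFa : ∀ a : ℝ, 0 < a → Integrable (fun w ↦ F a (u + h * w)) := fun a ha ↦
    ((hF a ha).comp_add_left u).comp_mul_left' hh.ne'
  have hpos : ∀ w : ℝ, |w| ≤ 1 → 0 < u + h * w := fun w hw ↦ by
    have := (abs_le.mp hw).1
    nlinarith
  obtain ⟨B, hB⟩ : ∃ B, ∀ w, ‖K w‖ ≤ B := by
    obtain ⟨B, -, hB⟩ := K.decay 0 0
    exact ⟨B, fun w ↦ by simpa using hB w⟩
  have hlim : Filter.Tendsto (fun a : ℝ ↦ ∫ w, F a (u + h * w) * K w) (nhdsWithin 0 (Set.Ioi 0))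
      (nhds (∫ w, E (u + h * w) * K w)) := by
    refine tendsto_integral_filter_of_dominated_convergence
      (fun w ↦ ‖F 1 (u + h * w)‖ * (Real.exp (u + h) * B)) ?_ ?_ ?_ ?_
    · filter_upwards [self_mem_nhdsWithin] with a ha
      exact (hFa a ha).aestronglyMeasurable.mul K.continuous.aestronglyMeasurable
    · filter_upwards [self_mem_nhdsWithin] with a ha
      have ha : 0 < a := ha
      refine .of_forall fun w ↦ ?_
      by_cases hw : |w| ≤ 1
      · have hp := hpos w hw
        have hp2 : u + h * w ≤ u + h := by have := (abs_le.mp hw).2; nlinarith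
        have i1 : u + h * w ∈ Set.Ioi (0 : ℝ) := hp
        simp only [F]
        rw [Set.indicator_of_mem i1, Set.indicator_of_mem i1, norm_mul, norm_mul, norm_mul,
          Complex.norm_exp, Complex.norm_exp, mul_assoc, mul_assoc]
        refine mul_le_mul_of_nonneg_left ?_ (norm_nonneg _)
        rw [← mul_assoc, ← Real.exp_add]
        have r1 : (-(((a : ℝ) : ℂ) * ((u + h * w : ℝ) : ℂ))).re = -(a * (u + h * w)) := by
          rw [← ofReal_mul, ← ofReal_neg, ofReal_re]
        have r2 : (-(((1 : ℝ) : ℂ) * ((u + h * w : ℝ) : ℂ))).re = -(u + h * w) := by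
          rw [← ofReal_mul, ← ofReal_neg, ofReal_re, one_mul]
        rw [r1, r2]
        have := hB w
        gcongr
        nlinarith [mul_pos ha hp]
      · rw [hK w (not_le.mp hw), mul_zero, norm_zero]
        have : 0 ≤ B := (norm_nonneg _).trans (hB w)
        positivity
    · exact (hFa 1 one_pos).norm.mul_const _
    · refine .of_forall fun w ↦ ?_
      by_cases hw : |w| ≤ 1
      · have i1 : u + h * w ∈ Set.Ioi (0 : ℝ) := hpos w hw
        have hc : Continuous fun a : ℝ ↦
            E (u + h * w) * cexp (-(a * ((u + h * w : ℝ) : ℂ))) * K w := by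
          fun_prop
        have := (hc.tendsto 0).mono_left (nhdsWithin_le_nhds (s := Set.Ioi 0))
        simp only [ofReal_zero, zero_mul, neg_zero, Complex.exp_zero, mul_one] at this
        refine this.congr fun a ↦ ?_
        simp only [F]
        rw [Set.indicator_of_mem i1]
      · simp [hK w (not_le.mp hw)]
  refine le_of_tendsto hlim.norm ?_
  filter_upwards [self_mem_nhdsWithin, nhdsWithin_le_nhds (gt_mem_nhds one_pos)] with a ha ha1
  have ha : 0 < a := ha
  refine hA' (F a) H a C (hF a ha) (fun z hz ↦ ?_) hd ha (fun z hz ↦ ?_) u h hh hh1 hu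
  · rw [hH z (hz ▸ ha), ← integral_indicator measurableSet_Ioi]
    refine integral_congr_ae (.of_forall fun v ↦ ?_)
    by_cases hv : v ∈ Set.Ioi (0 : ℝ)
    · simp only [F]
      rw [Set.indicator_of_mem hv, Set.indicator_of_mem hv, mul_assoc, ← Complex.exp_add]
      congr 2
      ring
    · simp only [F]
      rw [Set.indicator_of_notMem hv, Set.indicator_of_notMem hv, zero_mul]
  · exact hC z (hz ▸ ha) (hz ▸ ha1)

lemma exists_schwartz_bump : ∃ (ρ : ℝ → ℝ) (K : 𝓢(ℝ, ℂ)), (∀ w, K w = ρ w) ∧ (∀ w, 0 ≤ ρ w) ∧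
    (∀ w, 1 < |w| → ρ w = 0) ∧ Integrable ρ ∧ ∫ w, ρ w = 1 := by
  let f : ContDiffBump (0 : ℝ) := ⟨1 / 2, 1, by norm_num, by norm_num⟩
  have hc : HasCompactSupport (fun w ↦ ((f.normed volume w : ℝ) : ℂ)) :=
    f.hasCompactSupport_normed.comp_left (g := fun x : ℝ ↦ (x : ℂ)) ofReal_zero
  have hs : ContDiff ℝ (⊤ : ℕ∞) (fun w ↦ ((f.normed volume w : ℝ) : ℂ)) :=
    ofRealCLM.contDiff.comp f.contDiff_normed
  refine ⟨f.normed volume, hc.toSchwartzMap hs, fun w ↦ rfl, f.nonneg_normed, fun w hw ↦ ?_,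
    f.integrable_normed, f.integral_normed⟩
  have := f.support_normed_eq (μ := volume)
  by_contra h
  have h2 : w ∈ Metric.ball (0 : ℝ) f.rOut := this ▸ Function.mem_support.mpr h
  rw [mem_ball_zero_iff, Real.norm_eq_abs] at h2
  exact lt_asymm hw h2

lemma integrable_comp_affine_mul_schwartz (K : 𝓢(ℝ, ℂ)) (hK : ∀ w : ℝ, 1 < |w| → K w = 0)
    (E : ℝ → ℂ) (hE : IntegrableOn (fun v ↦ E v * cexp (-(((1 : ℝ) : ℂ) * v))) (Set.Ioi 0))
    {u h : ℝ} (hh : 0 < h) (hhu : h < u) : Integrable (fun w ↦ E (u + h * w) * K w) := by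
  let F : ℝ → ℂ := (Set.Ioi (0 : ℝ)).indicator fun v ↦ E v * cexp (-(((1 : ℝ) : ℂ) * v))
  have hF : Integrable F := (integrable_indicator_iff measurableSet_Ioi).mpr hE
  have hFa : Integrable (fun w ↦ F (u + h * w)) := (hF.comp_add_left u).comp_mul_left' hh.ne'
  obtain ⟨B, hB⟩ : ∃ B, ∀ w, ‖K w‖ ≤ B := by
    obtain ⟨B, -, hB⟩ := K.decay 0 0
    exact ⟨B, fun w ↦ by simpa using hB w⟩
  have hB0 : 0 ≤ B := (norm_nonneg _).trans (hB 0)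
  have hc : Continuous fun w : ℝ ↦ cexp ((u + h * w : ℝ) : ℂ) * K w := by
    have := K.continuous
    fun_prop
  refine (hFa.mul_bdd (c := Real.exp (u + h) * B) hc.aestronglyMeasurable
    (.of_forall fun w ↦ ?_)).congr (.of_forall fun w ↦ ?_)
  · by_cases hw : |w| ≤ 1
    · rw [norm_mul, Complex.norm_exp, ofReal_re]
      have hp2 : u + h * w ≤ u + h := by have := (abs_le.mp hw).2; nlinarith
      have := hB w
      gcongr
    · rw [hK w (not_le.mp hw), mul_zero, norm_zero]
      positivity
  · by_cases hw : |w| ≤ 1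
    · have i1 : u + h * w ∈ Set.Ioi (0 : ℝ) := by
        have := (abs_le.mp hw).1
        change 0 < u + h * w
        nlinarith
      simp only [F]
      rw [Set.indicator_of_mem i1, mul_assoc, ← mul_assoc (cexp _), ← Complex.exp_add]
      simp
    · simp [hK w (not_le.mp hw)]

lemma abs_le_of_smoothed {ρ e : ℝ → ℝ} (hρ : ∀ w, 0 ≤ ρ w) (hρ0 : ∀ w, 1 < |w| → ρ w = 0)
    (hρi : Integrable ρ) (hρ1 : ∫ w, ρ w = 1) {D : ℝ}
    (hI : ∀ u h : ℝ, 0 < h → h < u → Integrable (fun w ↦ e (u + h * w) * ρ w))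
    (hS : ∀ u h : ℝ, 0 < h → h ≤ 1 → h < u → |∫ w, e (u + h * w) * ρ w| ≤ D / (h * u ^ 2))
    (hmono : ∀ v v' : ℝ, 0 ≤ v → v ≤ v' → e v - (v' - v) ≤ e v') :
    ∃ B : ℝ, 0 ≤ B ∧ ∀ u : ℝ, 2 ≤ u → |e u| ≤ B / u := by
  have hD : 0 ≤ D := by
    have := (abs_nonneg _).trans (hS 2 1 one_pos le_rfl (by norm_num))
    norm_num at this
    linarith
  refine ⟨4 * D + 2, by positivity, fun u hu ↦ ?_⟩
  have hu0 : 0 < u := by linarith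
  have hh : 0 < 1 / u := by positivity
  have hh1 : 1 / u ≤ 1 / 2 := one_div_le_one_div_of_le (by norm_num) hu
  set h := 1 / u with hdef
  have hhu : h * u = 1 := by rw [hdef]; field_simp
  have hw : ∀ w : ℝ, (|w| ≤ 1 ∨ ρ w = 0) := fun w ↦ by
    by_cases hw : |w| ≤ 1
    · exact .inl hw
    · exact .inr (hρ0 w (not_le.mp hw))
  have hB : (4 * D + 2) / u = 4 * D * h + 2 * h := by rw [hdef]; field_simp
  rw [hB, abs_le]
  constructor
  · have h1 := hI (u - h) h hh (by linarith)
    have h2 := hS (u - h) h hh (by linarith) (by linarith)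
    have h3 : ∫ w, e (u - h + h * w) * ρ w ≤ ∫ w, (e u + 2 * h) * ρ w := by
      refine integral_mono h1 (hρi.const_mul _) fun w ↦ ?_
      rcases hw w with hw | hw
      · have a := abs_le.mp hw
        have b := hmono (u - h + h * w) u (by nlinarith) (by nlinarith)
        exact mul_le_mul_of_nonneg_right (by nlinarith) (hρ w)
      · simp [hw]
    rw [integral_const_mul, hρ1, mul_one] at h3
    have h4 : D / (h * (u - h) ^ 2) ≤ 4 * D * h := by
      rw [div_le_iff₀ (by have : 0 < u - h := by linarith
                          positivity)]
      have h5 : 1 / 4 ≤ h ^ 2 * (u - h) ^ 2 := by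
        have : h * (u - h) = 1 - h ^ 2 := by linear_combination hhu
        rw [← mul_pow, this]
        nlinarith
      calc D = 4 * D * (1 / 4) := by ring
        _ ≤ 4 * D * (h ^ 2 * (u - h) ^ 2) := by gcongr
        _ = _ := by ring
    have := (abs_le.mp h2).1
    linarith
  · have h1 := hI (u + h) h hh (by linarith)
    have h2 := hS (u + h) h hh (by linarith) (by linarith)
    have h3 : ∫ w, (e u - 2 * h) * ρ w ≤ ∫ w, e (u + h + h * w) * ρ w := by
      refine integral_mono (hρi.const_mul _) h1 fun w ↦ ?_
      rcases hw w with hw | hw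
      · have a := abs_le.mp hw
        have b := hmono u (u + h + h * w) hu0.le (by nlinarith)
        exact mul_le_mul_of_nonneg_right (by nlinarith) (hρ w)
      · simp [hw]
    rw [integral_const_mul, hρ1, mul_one] at h3
    have h4 : D / (h * (u + h) ^ 2) ≤ 4 * D * h := by
      rw [div_le_iff₀ (by positivity)]
      have h5 : 1 / 4 ≤ h ^ 2 * (u + h) ^ 2 := by
        have : h * (u + h) = 1 + h ^ 2 := by linear_combination hhu
        rw [← mul_pow, this]
        nlinarith
      calc D = 4 * D * (1 / 4) := by ring
        _ ≤ 4 * D * (h ^ 2 * (u + h) ^ 2) := by gcongr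
        _ = _ := by ring
    have := (abs_le.mp h2).2
    linarith

lemma norm_le_of_smoothed {ρ e : ℝ → ℝ} {E : ℝ → ℂ} (hρ : ∀ w, 0 ≤ ρ w)
    (hρ0 : ∀ w, 1 < |w| → ρ w = 0) (hρi : Integrable ρ) (hρ1 : ∫ w, ρ w = 1) {D B : ℝ}
    (hI : ∀ u h : ℝ, 0 < h → h < u → Integrable (fun w ↦ E (u + h * w) * ρ w))
    (hS : ∀ u h : ℝ, 0 < h → h ≤ 1 → h < u → ‖∫ w, E (u + h * w) * ρ w‖ ≤ D / (h * u ^ 2))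
    (he : ∀ u : ℝ, 2 ≤ u → |e u| ≤ B / u) (hB : 0 ≤ B)
    (hosc : ∀ v v' : ℝ, 0 ≤ v → v ≤ v' → ‖E v' - E v‖ ≤ e v' - e v + (v' - v)) :
    ∃ B' : ℝ, 0 ≤ B' ∧ ∀ u : ℝ, 3 ≤ u → ‖E u‖ ≤ B' / u := by
  have hD : 0 ≤ D := by
    have := (norm_nonneg _).trans (hS 2 1 one_pos le_rfl (by norm_num))
    norm_num at this
    linarith
  refine ⟨D + (3 * B + 1), by positivity, fun u hu ↦ ?_⟩
  have hu0 : 0 < u := by linarith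
  have hh : 0 < 1 / u := by positivity
  have hh1 : 1 / u ≤ 1 / 3 := one_div_le_one_div_of_le (by norm_num) hu
  set h := 1 / u with hdef
  have h1 := hI u h hh (by linarith)
  have h2 := hS u h hh (by linarith) (by linarith)
  have h2' : D / (h * u ^ 2) = D / u := by rw [hdef]; field_simp
  rw [h2'] at h2
  have ee : ∀ v, u / 2 ≤ v → 2 ≤ v → |e v| ≤ 2 * B / u := fun v hv hv2 ↦ by
    refine (he v hv2).trans ?_
    rw [div_le_div_iff₀ (by linarith) hu0]
    nlinarith
  have osc : ∀ w : ℝ, |w| ≤ 1 → ‖E u - E (u + h * w)‖ ≤ (3 * B + 1) / u := by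
    intro w hw
    have a := abs_le.mp hw
    have b1 := abs_le.mp (ee (u + h * w) (by nlinarith) (by nlinarith))
    have b2 := abs_le.mp (he u (by linarith))
    have hb : (3 * B + 1) / u = 2 * B / u + B / u + h := by rw [hdef]; ring
    rw [hb]
    rcases le_total 0 w with hw0 | hw0
    · have := hosc u (u + h * w) hu0.le (by nlinarith)
      rw [norm_sub_rev] at this
      nlinarith
    · have := hosc (u + h * w) u (by nlinarith) (by nlinarith)
      nlinarith
  have h3 : E u - ∫ w, E (u + h * w) * ρ w = ∫ w, (E u - E (u + h * w)) * ρ w := by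
    simp_rw [sub_mul]
    have h0 : Integrable (fun w ↦ E u * (ρ w : ℂ)) := (hρi.ofReal (𝕜 := ℂ)).const_mul _
    rw [integral_sub h0 h1, integral_const_mul, integral_complex_ofReal, hρ1, ofReal_one, mul_one]
  have h4 : ‖∫ w, (E u - E (u + h * w)) * ρ w‖ ≤ (3 * B + 1) / u := by
    have : ∫ w, (3 * B + 1) / u * ρ w = (3 * B + 1) / u := by
      rw [integral_const_mul, hρ1, mul_one]
    rw [← this]
    refine norm_integral_le_of_norm_le (hρi.const_mul _) (.of_forall fun w ↦ ?_)
    rw [norm_mul, norm_real, Real.norm_of_nonneg (hρ w)]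
    by_cases hw : |w| ≤ 1
    · exact mul_le_mul_of_nonneg_right (osc w hw) (hρ w)
    · simp [hρ0 w (not_le.mp hw)]
  calc ‖E u‖ = ‖(E u - ∫ w, E (u + h * w) * ρ w) + ∫ w, E (u + h * w) * ρ w‖ := by
        rw [sub_add_cancel]
    _ ≤ (3 * B + 1) / u + D / u := (norm_add_le _ _).trans (add_le_add (h3 ▸ h4) h2)
    _ = _ := by ring

end Smoothing

section Laplace

open MeasureTheory

lemma setIntegral_Ici_indicator {V : Type*} [NormedAddCommGroup V] [NormedSpace ℝ V] {l : ℝ}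
    (hl : 0 ≤ l) (g : ℝ → V) :
    ∫ v in Set.Ici (0 : ℝ), (Set.Ici l).indicator g v = ∫ v in Set.Ioi l, g v := by
  rw [setIntegral_indicator measurableSet_Ici,
    Set.inter_eq_self_of_subset_right (Set.Ici_subset_Ici.mpr hl), integral_Ici_eq_integral_Ioi]

lemma log_le_iff_mem_Icc {n : ℕ} {v : ℝ} (hn : n ≠ 0) :
    Real.log n ≤ v ↔ n ∈ Finset.Icc 1 ⌊Real.exp v⌋₊ := by
  have : (0 : ℝ) < n := by exact_mod_cast Nat.pos_of_ne_zero hn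
  rw [Finset.mem_Icc, Nat.le_floor_iff (Real.exp_pos v).le, Real.log_le_iff_le_exp this]
  simp [Nat.one_le_iff_ne_zero, hn]

lemma integral_partialSum_mul_exp {a : ℕ → ℂ} {z : ℂ} (hz : 0 < z.re)
    (ha : LSeriesSummable a (1 + z)) :
    ∫ v in Set.Ioi (0 : ℝ), (∑ n ∈ Finset.Icc 1 ⌊Real.exp v⌋₊, a n / n) * cexp (-(z * v)) =
      LSeries a (1 + z) / z := by
  have hz' : (-z).re < 0 := by simpa using hz
  have hz0 : z ≠ 0 := by rintro rfl; simp at hz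
  let F : ℕ → ℝ → ℂ := fun n v ↦
    (if n = 0 then 0 else a n / n) * (Set.Ici (Real.log n)).indicator (fun v ↦ cexp (-z * v)) v
  have hlog : ∀ n : ℕ, 0 ≤ Real.log n := fun n ↦ Real.log_natCast_nonneg n
  have hterm : ∀ n : ℕ, LSeries.term a (1 + z) n =
      (if n = 0 then 0 else a n / n) * cexp (-z * Real.log n) := by
    intro n
    by_cases hn : n = 0
    · simp [hn]
    · have hn' : (n : ℂ) ≠ 0 := by exact_mod_cast hn
      rw [LSeries.term_of_ne_zero hn, if_neg hn, cpow_add _ _ hn', cpow_one,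
        cpow_def_of_ne_zero hn', ← div_div, div_eq_mul_inv _ (cexp _), ← Complex.exp_neg,
        natCast_log]
      congr 2
      ring
  have hFint : ∀ n, Integrable (F n) (volume.restrict (Set.Ici 0)) := by
    intro n
    refine Integrable.const_mul ?_ _
    refine Integrable.indicator ?_ measurableSet_Ici
    exact (integrableOn_Ici_iff_integrableOn_Ioi (by finiteness)).mpr
      (integrableOn_exp_mul_complex_Ioi hz' 0)
  have hFval : ∀ n, ∫ v in Set.Ici (0 : ℝ), F n v = LSeries.term a (1 + z) n / z := by
    intro n
    rw [integral_const_mul, setIntegral_Ici_indicator (hlog n), integral_exp_mul_complex_Ioi hz',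
      hterm]
    field_simp
  have hFnorm : ∀ n, ∫ v in Set.Ici (0 : ℝ), ‖F n v‖ = ‖LSeries.term a (1 + z) n‖ / z.re := by
    intro n
    have h1 : ∀ v, ‖F n v‖ = ‖(if n = 0 then 0 else a n / n : ℂ)‖ *
        (Set.Ici (Real.log n)).indicator (fun v ↦ Real.exp (-z.re * v)) v := by
      intro v
      rw [norm_mul, norm_indicator_eq_indicator_norm]
      congr 3
      ext v
      rw [Complex.norm_exp, re_mul_ofReal, neg_re]
    simp_rw [h1]
    rw [integral_const_mul, setIntegral_Ici_indicator (hlog n),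
      integral_exp_mul_Ioi (by linarith), hterm, norm_mul, Complex.norm_exp, re_mul_ofReal, neg_re]
    field_simp
  have hsum := hasSum_integral_of_summable_integral_norm hFint (by
    simp_rw [hFnorm]
    exact ha.norm.div_const _)
  simp_rw [hFval] at hsum
  have h2 := (ha.hasSum.div_const z).unique hsum
  rw [LSeries, h2, integral_Ici_eq_integral_Ioi]
  refine integral_congr_ae (.of_forall fun v ↦ ?_)
  beta_reduce
  rw [tsum_eq_sum (s := Finset.Icc 1 ⌊Real.exp v⌋₊), Finset.sum_mul]
  · refine Finset.sum_congr rfl fun n hn ↦ ?_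
    have hn0 : n ≠ 0 := by have := (Finset.mem_Icc.mp hn).1; omega
    have : v ∈ Set.Ici (Real.log n) := (log_le_iff_mem_Icc hn0).mpr hn
    simp only [F]
    rw [if_neg hn0, Set.indicator_of_mem this, neg_mul]
  · intro n hn
    by_cases hn0 : n = 0
    · simp [F, hn0]
    · have : v ∉ Set.Ici (Real.log n) := fun h ↦ hn ((log_le_iff_mem_Icc hn0).mp h)
      simp only [F]
      rw [Set.indicator_of_notMem this, mul_zero]

lemma integrableOn_partialSum_mul_exp {a : ℕ → ℂ} {z : ℂ} (hz : 0 < z.re)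
    (ha : LSeriesSummable a (1 + z.re / 2)) :
    IntegrableOn (fun v : ℝ ↦ (∑ n ∈ Finset.Icc 1 ⌊Real.exp v⌋₊, a n / n) * cexp (-(z * v)))
      (Set.Ioi 0) := by
  have hm : Measurable (fun v : ℝ ↦ ∑ n ∈ Finset.Icc 1 ⌊Real.exp v⌋₊, a n / n) :=
    (measurable_from_nat (f := fun N : ℕ ↦ ∑ n ∈ Finset.Icc 1 N, a n / n)).comp
      (Nat.measurable_floor.comp Real.measurable_exp)
  have hm2 : Measurable (fun v : ℝ ↦ cexp (-(z * v))) := by fun_prop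
  have hbound : Integrable (fun v : ℝ ↦ (∑' n, ‖LSeries.term a (1 + z.re / 2) n‖) *
      Real.exp (-(z.re / 2) * v)) (volume.restrict (Set.Ioi 0)) :=
    (integrableOn_exp_mul_Ioi (by linarith) 0).const_mul _
  refine hbound.mono' (hm.mul hm2).aestronglyMeasurable (.of_forall fun v ↦ ?_)
  rw [norm_mul, Complex.norm_exp]
  have e : (-(z * v)).re = z.re / 2 * (-v) + -(z.re / 2) * v := by simp; ring
  rw [e, Real.exp_add, ← mul_assoc]
  gcongr
  have h1 : ‖∑ n ∈ Finset.Icc 1 ⌊Real.exp v⌋₊, a n / n‖ ≤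
      ∑ n ∈ Finset.Icc 1 ⌊Real.exp v⌋₊, ‖LSeries.term a (1 + z.re / 2) n‖ *
        Real.exp (z.re / 2 * v) := by
    refine norm_sum_le_of_le _ fun n hn ↦ ?_
    have hn0 : n ≠ 0 := by have := (Finset.mem_Icc.mp hn).1; omega
    have hn' : (0 : ℝ) < n := by exact_mod_cast Nat.pos_of_ne_zero hn0
    rw [LSeries.term_of_ne_zero hn0, norm_div, norm_div, norm_natCast,
      Complex.norm_natCast_cpow_of_pos (Nat.pos_of_ne_zero hn0)]
    have hre : (1 + (z.re : ℂ) / 2).re = 1 + z.re / 2 := by simp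
    have h3 : (n : ℝ) ^ (z.re / 2) ≤ Real.exp (z.re / 2 * v) := by
      rw [Real.rpow_def_of_pos hn', mul_comm]
      have := (log_le_iff_mem_Icc hn0).mpr hn
      gcongr
    rw [hre, Real.rpow_add hn', Real.rpow_one]
    calc ‖a n‖ / n = ‖a n‖ / (n * (n : ℝ) ^ (z.re / 2)) * (n : ℝ) ^ (z.re / 2) := by
          field_simp
      _ ≤ _ := by gcongr
  refine (mul_le_mul_of_nonneg_right h1 (Real.exp_pos _).le).trans ?_
  rw [← Finset.sum_mul, mul_assoc, ← Real.exp_add, mul_neg, add_neg_cancel, Real.exp_zero, mul_one]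
  exact ha.norm.sum_le_tsum _ fun _ _ ↦ norm_nonneg _

lemma integrableOn_id_mul_exp {z : ℂ} (hz : 0 < z.re) :
    IntegrableOn (fun v : ℝ ↦ (v : ℂ) * cexp (-(z * v))) (Set.Ioi 0) := by
  have h := integrableOn_rpow_mul_exp_neg_mul_rpow (s := 1) (p := 1) (by norm_num) one_pos hz
  have hc : Continuous (fun v : ℝ ↦ (v : ℂ) * cexp (-(z * v))) := by fun_prop
  refine Integrable.mono' h hc.aestronglyMeasurable ?_
  filter_upwards [self_mem_ae_restrict measurableSet_Ioi] with v hv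
  have hv : 0 < v := hv
  rw [norm_mul, norm_real, Real.norm_of_nonneg hv.le, Complex.norm_exp, Real.rpow_one]
  simp

lemma integrableOn_const_mul_exp {z : ℂ} (hz : 0 < z.re) (c : ℂ) :
    IntegrableOn (fun v : ℝ ↦ c * cexp (-(z * v))) (Set.Ioi 0) := by
  simp_rw [← neg_mul]
  exact (integrableOn_exp_mul_complex_Ioi (by simpa using hz) 0).const_mul c

lemma integral_const_mul_exp {z : ℂ} (hz : 0 < z.re) (c : ℂ) :
    ∫ v in Set.Ioi (0 : ℝ), c * cexp (-(z * v)) = c / z := by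
  simp_rw [← neg_mul]
  rw [integral_const_mul, integral_exp_mul_complex_Ioi (by simpa using hz)]
  simp [div_eq_mul_inv]

lemma integral_id_mul_exp {z : ℂ} (hz : 0 < z.re) :
    ∫ v in Set.Ioi (0 : ℝ), (v : ℂ) * cexp (-(z * v)) = 1 / z ^ 2 := by
  have hz0 : z ≠ 0 := by rintro rfl; simp at hz
  let f : ℝ → ℂ := fun v ↦ -(1 / z) * (v * cexp (-(z * v))) - 1 / z ^ 2 * cexp (-(z * v))
  have hd : ∀ v : ℝ, HasDerivAt f ((v : ℂ) * cexp (-(z * v))) v := by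
    intro v
    have h1 : HasDerivAt (fun v : ℝ ↦ (v : ℂ)) 1 v := Complex.ofRealCLM.hasDerivAt
    have h2 : HasDerivAt (fun v : ℝ ↦ cexp (-(z * v))) (cexp (-(z * v)) * -(z * 1)) v :=
      (h1.const_mul z).neg.cexp
    have h3 : HasDerivAt f _ v :=
      ((h1.mul h2).const_mul (-(1 / z))).sub (h2.const_mul (1 / z ^ 2))
    refine h3.congr_deriv ?_
    field_simp
    ring
  have hInt := integrableOn_id_mul_exp hz
  have hf : IntegrableOn f (Set.Ioi 0) :=
    (hInt.const_mul _).sub (integrableOn_const_mul_exp hz (1 / z ^ 2))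
  have ht := tendsto_zero_of_hasDerivAt_of_integrableOn_Ioi (fun v _ ↦ hd v) hInt hf
  rw [integral_Ioi_of_hasDerivAt_of_tendsto' (fun v _ ↦ hd v) hInt ht]
  simp [f]

end Laplace

section Mertens

open MeasureTheory
open scoped SchwartzMap

/-- The error term in Mertens' theorem for `∑ χ(n) Λ(n) / n`, in logarithmic scale. -/
noncomputable def mertensError {N : ℕ} (χ : DirichletCharacter ℂ N) (r c : ℂ) (v : ℝ) : ℂ :=
  (∑ n ∈ Finset.Icc 1 ⌊Real.exp v⌋₊, χ n * ArithmeticFunction.vonMangoldt n / n) - r * v - c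

lemma integrableOn_mertensError_mul_exp {N : ℕ} (χ : DirichletCharacter ℂ N) (r c : ℂ) {z : ℂ}
    (hz : 0 < z.re) :
    IntegrableOn (fun v : ℝ ↦ mertensError χ r c v * cexp (-(z * v))) (Set.Ioi 0) := by
  have hs : 1 < (1 + (z.re : ℂ) / 2).re := by simpa using hz
  have h := ((integrableOn_partialSum_mul_exp hz (LSeriesSummable_twist_vonMangoldt χ hs)).sub
    ((integrableOn_id_mul_exp hz).const_mul r)).sub (integrableOn_const_mul_exp hz c)
  refine h.congr (.of_forall fun v ↦ ?_)
  simp only [mertensError, Pi.sub_apply, Pi.mul_apply]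
  ring

lemma integral_mertensError_mul_exp {N : ℕ} [NeZero N] (χ : DirichletCharacter ℂ N) (r c : ℂ)
    {z : ℂ} (hz : 0 < z.re) :
    ∫ v in Set.Ioi (0 : ℝ), mertensError χ r c v * cexp (-(z * v)) =
      logDerivTransform χ r c z := by
  have hs : 1 < (1 + (z.re : ℂ) / 2).re := by simpa using hz
  have hs' : 1 < (1 + z).re := by simpa using hz
  have hz0 : z ≠ 0 := by rintro rfl; simp at hz
  have i1 := integrableOn_partialSum_mul_exp hz (LSeriesSummable_twist_vonMangoldt χ hs)
  have i2 := (integrableOn_id_mul_exp hz).const_mul r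
  have i3 := integrableOn_const_mul_exp hz c
  have e : ∀ v : ℝ, mertensError χ r c v * cexp (-(z * v)) =
      (∑ n ∈ Finset.Icc 1 ⌊Real.exp v⌋₊, ((fun n : ℕ ↦ χ n) *
        fun n ↦ (ArithmeticFunction.vonMangoldt n : ℂ)) n / n) * cexp (-(z * v)) -
      r * (v * cexp (-(z * v))) - c * cexp (-(z * v)) := by
    intro v
    simp only [mertensError, Pi.mul_apply]
    ring
  simp_rw [e]
  refine (integral_sub (i1.sub i2) i3).trans ?_
  simp only [Pi.sub_apply]
  rw [integral_sub i1 i2, integral_const_mul,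
    integral_partialSum_mul_exp hz (LSeriesSummable_twist_vonMangoldt χ hs'),
    integral_id_mul_exp hz, integral_const_mul_exp hz, LSeries_twist_vonMangoldt_eq χ hs',
    ← LFunction_eq_LSeries χ hs', ← deriv_LFunction_eq_deriv_LSeries χ hs', logDerivTransform]
  field_simp

lemma exists_mertensError_smoothed {N : ℕ} [NeZero N] (χ : DirichletCharacter ℂ N) (K : 𝓢(ℝ, ℂ))
    (hK : ∀ w : ℝ, 1 < |w| → K w = 0) :
    ∃ c : ℂ, (χ ≠ 1 → c = -(deriv (LFunction χ) 1 / LFunction χ 1)) ∧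
      (∀ u h : ℝ, 0 < h → h < u →
        Integrable (fun w ↦ mertensError χ (poleOrder χ) c (u + h * w) * K w)) ∧
      ∃ D : ℝ, ∀ u h : ℝ, 0 < h → h ≤ 1 → h < u →
        ‖∫ w, mertensError χ (poleOrder χ) c (u + h * w) * K w‖ ≤ D / (h * u ^ 2) := by
  obtain ⟨c, hc, hH, C, hC⟩ := exists_logDerivTransform_bound χ
  obtain ⟨A, -, hA⟩ := norm_smoothed_le K hK
  refine ⟨c, hc, fun u h hh hhu ↦ ?_, A * C, fun u h hh hh1 hhu ↦ ?_⟩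
  · exact integrable_comp_affine_mul_schwartz K hK _
      (integrableOn_mertensError_mul_exp χ _ c (by simp)) hh hhu
  · refine hA _ (logDerivTransform χ (poleOrder χ) c) C (fun a ha ↦ ?_) (fun z hz ↦ ?_) hH hC u h
      hh hh1 hhu
    · exact integrableOn_mertensError_mul_exp χ _ c (by simpa using ha)
    · exact (integral_mertensError_mul_exp χ _ c hz).symm

lemma sum_Icc_floor_exp_mono {v v' : ℝ} (h : v ≤ v') :
    Finset.Icc 1 ⌊Real.exp v⌋₊ ⊆ Finset.Icc 1 ⌊Real.exp v'⌋₊ :=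
  Finset.Icc_subset_Icc_right (Nat.floor_le_floor (Real.exp_le_exp.mpr h))

lemma exists_mertens_exp :
    ∃ c B : ℝ, 0 ≤ B ∧ ∀ u : ℝ, 2 ≤ u →
      |(∑ n ∈ Finset.Icc 1 ⌊Real.exp u⌋₊, ArithmeticFunction.vonMangoldt n / n) - u - c| ≤
        B / u := by
  obtain ⟨ρ, K, hKρ, hρ, hρ0, hρi, hρ1⟩ := exists_schwartz_bump
  have hK : ∀ w : ℝ, 1 < |w| → K w = 0 := fun w hw ↦ by rw [hKρ, hρ0 w hw, ofReal_zero]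
  obtain ⟨c, -, hI, D, hD⟩ := exists_mertensError_smoothed (1 : DirichletCharacter ℂ 1) K hK
  have hre : ∀ v w : ℝ, (mertensError (1 : DirichletCharacter ℂ 1)
      (poleOrder (1 : DirichletCharacter ℂ 1)) c v * K w).re =
      ((∑ n ∈ Finset.Icc 1 ⌊Real.exp v⌋₊, ArithmeticFunction.vonMangoldt n / n) - v - c.re) *
        ρ w := by
    intro v w
    rw [hKρ, re_mul_ofReal, mertensError, poleOrder, if_pos rfl]
    congr 1
    have : ∀ n : ℕ, (1 : DirichletCharacter ℂ 1) (n : ZMod 1) = 1 := fun n ↦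
      MulChar.one_apply (isUnit_of_subsingleton _)
    simp_rw [this]
    have e : (∑ n ∈ Finset.Icc 1 ⌊Real.exp v⌋₊, (1 : ℂ) * ArithmeticFunction.vonMangoldt n / n) =
        ((∑ n ∈ Finset.Icc 1 ⌊Real.exp v⌋₊, ArithmeticFunction.vonMangoldt n / n : ℝ) : ℂ) := by
      push_cast
      simp
    rw [e]
    simp
  have key := abs_le_of_smoothed (e := fun v ↦
    (∑ n ∈ Finset.Icc 1 ⌊Real.exp v⌋₊, ArithmeticFunction.vonMangoldt n / n) - v - c.re)
    hρ hρ0 hρi hρ1 (D := D)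
  simp_rw [← hre] at key
  refine ⟨c.re, key (fun u h hh hhu ↦ (hI u h hh hhu).re) (fun u h hh hh1 hhu ↦ ?_)
    fun v v' _ hv ↦ ?_⟩
  · refine le_trans ?_ (hD u h hh hh1 hhu)
    refine le_trans (le_of_eq ?_) (Complex.abs_re_le_norm _)
    congr 1
    exact integral_re (hI u h hh hhu)
  · have := Finset.sum_le_sum_of_subset_of_nonneg (sum_Icc_floor_exp_mono hv)
      (f := fun n : ℕ ↦ ArithmeticFunction.vonMangoldt n / n) fun n _ _ ↦
        div_nonneg ArithmeticFunction.vonMangoldt_nonneg n.cast_nonneg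
    linarith

lemma exists_mertens_character_exp {N : ℕ} [NeZero N] (χ : DirichletCharacter ℂ N) (hχ : χ ≠ 1) :
    ∃ B : ℝ, 0 ≤ B ∧ ∀ u : ℝ, 3 ≤ u →
      ‖(∑ n ∈ Finset.Icc 1 ⌊Real.exp u⌋₊, χ n * ArithmeticFunction.vonMangoldt n / n) -
        -(deriv (LFunction χ) 1 / LFunction χ 1)‖ ≤ B / u := by
  obtain ⟨ρ, K, hKρ, hρ, hρ0, hρi, hρ1⟩ := exists_schwartz_bump
  have hK : ∀ w : ℝ, 1 < |w| → K w = 0 := fun w hw ↦ by rw [hKρ, hρ0 w hw, ofReal_zero]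
  obtain ⟨c, hc, hI, D, hD⟩ := exists_mertensError_smoothed χ K hK
  obtain ⟨c₀, B, hB, h⟩ := exists_mertens_exp
  have hE : ∀ v, mertensError χ (poleOrder χ) c v =
      (∑ n ∈ Finset.Icc 1 ⌊Real.exp v⌋₊, χ n * ArithmeticFunction.vonMangoldt n / n) - c := by
    intro v
    simp [mertensError, poleOrder, hχ]
  simp_rw [hKρ, hE] at hI hD
  rw [← hc hχ]
  refine norm_le_of_smoothed hρ hρ0 hρi hρ1 hI hD h hB fun v v' _ hv ↦ ?_
  have hsub := sum_Icc_floor_exp_mono hv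
  rw [sub_sub_sub_cancel_right, ← Finset.sum_sdiff hsub, add_sub_cancel_right,
    ← Finset.sum_sdiff hsub (f := fun n : ℕ ↦ ArithmeticFunction.vonMangoldt n / n)]
  have h1 := norm_sum_le_of_le (Finset.Icc 1 ⌊Real.exp v'⌋₊ \ Finset.Icc 1 ⌊Real.exp v⌋₊)
    (f := fun n : ℕ ↦ χ n * ArithmeticFunction.vonMangoldt n / n)
    (n := fun n ↦ ArithmeticFunction.vonMangoldt n / n) fun n _ ↦ by
      rw [norm_div, norm_mul, norm_natCast, norm_real,
        Real.norm_of_nonneg ArithmeticFunction.vonMangoldt_nonneg]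
      gcongr
      exact mul_le_of_le_one_left ArithmeticFunction.vonMangoldt_nonneg (χ.norm_le_one _)
  linarith

end Mertens

section PartialSummation

lemma norm_sum_mul_log_sub_le {a : ℕ → ℂ} {r : ℂ} {B : ℝ}
    (ha : ∀ N : ℕ, 1 ≤ N → ‖(∑ n ∈ Finset.Icc 1 N, a n) - r * Real.log N‖ ≤ B) {N : ℕ}
    (hN : 1 ≤ N) :
    ‖(∑ n ∈ Finset.Icc 1 N, a n * Real.log n) - r * (Real.log N : ℂ) ^ 2 / 2‖ ≤
      (2 * B + ‖r‖) * Real.log N := by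
  have hG : ‖(∑ n ∈ Finset.Icc 1 N, a n * Real.log n) -
      (∑ n ∈ Finset.Icc 1 N, a n) * Real.log N + r * (Real.log N : ℂ) ^ 2 / 2‖ ≤
      (B + ‖r‖) * Real.log N := by
    induction N, hN using Nat.le_induction with
    | base => simp
    | succ k hk ih =>
      have hk0 : (0 : ℝ) < k := by exact_mod_cast hk
      have hΔ0 : 0 ≤ Real.log (k + 1 : ℕ) - Real.log k :=
        sub_nonneg.mpr (Real.log_le_log hk0 (by push_cast; linarith))
      have hΔ1 : Real.log (k + 1 : ℕ) - Real.log k ≤ 1 := by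
        rw [← Real.log_div (by positivity) hk0.ne']
        refine (Real.log_le_sub_one_of_pos (by positivity)).trans ?_
        have : ((k + 1 : ℕ) : ℝ) / k = 1 + 1 / k := by push_cast; field_simp
        rw [this, add_sub_cancel_left, div_le_one hk0]
        exact_mod_cast hk
      rw [Finset.sum_Icc_succ_top (by omega), Finset.sum_Icc_succ_top (by omega)]
      set l := Real.log k
      set l' := Real.log (k + 1 : ℕ)
      set f := ∑ n ∈ Finset.Icc 1 k, a n
      set g := ∑ n ∈ Finset.Icc 1 k, a n * Real.log n
      have e : g + a (k + 1) * l' - (f + a (k + 1)) * l' + r * (l' : ℂ) ^ 2 / 2 =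
          (g - f * l + r * (l : ℂ) ^ 2 / 2) +
          ((l' - l : ℝ) : ℂ) * (r * ((l' - l : ℝ) : ℂ) / 2 - (f - r * l)) := by
        push_cast
        ring
      rw [e]
      have h1 : ‖r * ((l' - l : ℝ) : ℂ) / 2 - (f - r * l)‖ ≤ B + ‖r‖ := by
        refine (norm_sub_le _ _).trans ?_
        have h2 : ‖r * ((l' - l : ℝ) : ℂ) / 2‖ ≤ ‖r‖ := by
          rw [norm_div, norm_mul, norm_real, Real.norm_of_nonneg hΔ0]
          have := norm_nonneg r
          norm_num
          nlinarith
        linarith [ha k hk]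
      calc _ ≤ (B + ‖r‖) * l + (l' - l) * (B + ‖r‖) := by
            refine (norm_add_le _ _).trans (add_le_add ih ?_)
            rw [norm_mul, norm_real, Real.norm_of_nonneg hΔ0]
            gcongr
        _ = _ := by ring
  have hl : 0 ≤ Real.log N := Real.log_natCast_nonneg N
  have e : (∑ n ∈ Finset.Icc 1 N, a n * Real.log n) - r * (Real.log N : ℂ) ^ 2 / 2 =
      ((∑ n ∈ Finset.Icc 1 N, a n * Real.log n) -
      (∑ n ∈ Finset.Icc 1 N, a n) * Real.log N + r * (Real.log N : ℂ) ^ 2 / 2) +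
      ((∑ n ∈ Finset.Icc 1 N, a n) - r * Real.log N) * Real.log N := by ring
  rw [e]
  refine (norm_add_le _ _).trans ?_
  rw [norm_mul, norm_real, Real.norm_of_nonneg hl]
  have := mul_le_mul_of_nonneg_right (ha N hN) hl
  linarith

lemma log_sub_log_floor {t : ℝ} (ht : 1 ≤ t) :
    0 ≤ Real.log ⌊t⌋₊ ∧ Real.log ⌊t⌋₊ ≤ Real.log t ∧ Real.log t ≤ Real.log ⌊t⌋₊ + 1 := by
  have h1 : 1 ≤ ⌊t⌋₊ := Nat.one_le_floor_iff t |>.mpr ht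
  have h1' : (1 : ℝ) ≤ ⌊t⌋₊ := by exact_mod_cast h1
  refine ⟨Real.log_natCast_nonneg _, Real.log_le_log (by linarith) (Nat.floor_le (by linarith)), ?_⟩
  have h2 : t ≤ ⌊t⌋₊ * Real.exp 1 := by
    have := Nat.lt_floor_add_one t
    have := Real.add_one_le_exp (1 : ℝ)
    nlinarith
  calc Real.log t ≤ Real.log (⌊t⌋₊ * Real.exp 1) := Real.log_le_log (by linarith) h2
    _ = _ := by rw [Real.log_mul (by positivity) (Real.exp_ne_zero _), Real.log_exp]

/-- If the partial sums of `a` are asymptotic to `r log` with error decaying like `1 / log`, then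
those of `a · log` are `r log² / 2 + O(log)`. -/
lemma exists_sum_mul_log_bound {a : ℕ → ℂ} {r c : ℂ} {B : ℝ}
    (ha : ∀ t : ℝ, 0 < t → 3 ≤ Real.log t →
      ‖(∑ n ∈ Finset.Icc 1 ⌊t⌋₊, a n) - r * Real.log t - c‖ ≤
      B / Real.log t) :
    ∃ B' : ℝ, 0 ≤ B' ∧ ∀ t : ℝ, 1 ≤ t →
      ‖(∑ n ∈ Finset.Icc 1 ⌊t⌋₊, a n * Real.log n) - r * (Real.log t : ℂ) ^ 2 / 2‖ ≤
        B' * Real.log t := by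
  have hB : 0 ≤ B := by
    have := (norm_nonneg _).trans (ha (Real.exp 3) (Real.exp_pos 3) (by rw [Real.log_exp]))
    rw [Real.log_exp] at this
    linarith
  obtain ⟨B₀, hB₀, h0⟩ : ∃ B₀ : ℝ, 0 ≤ B₀ ∧ ∀ N : ℕ, 1 ≤ N →
      ‖(∑ n ∈ Finset.Icc 1 N, a n) - r * Real.log N‖ ≤ B₀ := by
    let M := ⌊Real.exp 3⌋₊ + 1
    refine ⟨(B + ‖c‖) + ∑ k ∈ Finset.range M, ‖(∑ n ∈ Finset.Icc 1 k, a n) - r * Real.log k‖,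
      by positivity, fun N hN ↦ ?_⟩
    by_cases hNM : N < M
    · have := Finset.single_le_sum
        (f := fun k : ℕ ↦ ‖(∑ n ∈ Finset.Icc 1 k, a n) - r * Real.log k‖)
        (fun k _ ↦ norm_nonneg _) (Finset.mem_range.mpr hNM)
      have := norm_nonneg c
      linarith
    · have h3 : 3 ≤ Real.log N := by
        have hN' : Real.exp 3 < N := (Nat.floor_lt (Real.exp_pos 3).le).mp (by omega)
        exact (Real.le_log_iff_exp_le (by exact_mod_cast hN)).mpr hN'.le
      have h := ha N (by exact_mod_cast hN) h3
      rw [Nat.floor_natCast] at h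
      have h4 : B / Real.log N ≤ B := div_le_self hB (by linarith)
      have h5 : 0 ≤ ∑ k ∈ Finset.range M, ‖(∑ n ∈ Finset.Icc 1 k, a n) - r * Real.log k‖ := by
        positivity
      have h6 := norm_add_le ((∑ n ∈ Finset.Icc 1 N, a n) - r * Real.log N - c) c
      rw [sub_add_cancel] at h6
      linarith
  refine ⟨2 * B₀ + ‖r‖ + ‖r‖, by positivity, fun t ht ↦ ?_⟩
  obtain ⟨h1, h2, h3⟩ := log_sub_log_floor ht
  have h4 := norm_sum_mul_log_sub_le h0 (Nat.one_le_floor_iff t |>.mpr ht)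
  set l := Real.log t
  set l' := Real.log ⌊t⌋₊
  set g := ∑ n ∈ Finset.Icc 1 ⌊t⌋₊, a n * Real.log n
  have e : g - r * (l : ℂ) ^ 2 / 2 =
      (g - r * (l' : ℂ) ^ 2 / 2) + r * (((l' ^ 2 - l ^ 2) / 2 : ℝ) : ℂ) := by
    push_cast
    ring
  rw [e]
  refine (norm_add_le _ _).trans ?_
  have h5 : |(l' ^ 2 - l ^ 2) / 2| ≤ l := by
    rw [abs_le]
    constructor <;> nlinarith
  rw [norm_mul, norm_real, Real.norm_eq_abs]
  have h6 : (2 * B₀ + ‖r‖) * l' ≤ (2 * B₀ + ‖r‖) * l := by gcongr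
  have h7 : ‖r‖ * |(l' ^ 2 - l ^ 2) / 2| ≤ ‖r‖ * l := by gcongr
  linarith

end PartialSummation

section Mertens

lemma exists_mertens :
    ∃ (c : ℂ) (B : ℝ), 0 ≤ B ∧ ∀ t : ℝ, 0 < t → 3 ≤ Real.log t →
      ‖(∑ n ∈ Finset.Icc 1 ⌊t⌋₊, (ArithmeticFunction.vonMangoldt n : ℂ) / n) -
        (1 : ℂ) * Real.log t - c‖ ≤ B / Real.log t := by
  obtain ⟨c, B, hB, h⟩ := exists_mertens_exp
  refine ⟨c, B, hB, fun t ht0 ht ↦ ?_⟩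
  have := h (Real.log t) (by linarith)
  rw [Real.exp_log ht0] at this
  rw [← Real.norm_eq_abs, ← norm_real] at this
  push_cast at this
  rwa [one_mul]

lemma exists_mertens_character {N : ℕ} [NeZero N] (χ : DirichletCharacter ℂ N) (hχ : χ ≠ 1) :
    ∃ B : ℝ, 0 ≤ B ∧ ∀ t : ℝ, 0 < t → 3 ≤ Real.log t →
      ‖(∑ n ∈ Finset.Icc 1 ⌊t⌋₊, χ n * ArithmeticFunction.vonMangoldt n / n) -
        (0 : ℂ) * Real.log t - -(deriv (LFunction χ) 1 / LFunction χ 1)‖ ≤ B / Real.log t := by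
  obtain ⟨B, hB, h⟩ := exists_mertens_character_exp χ hχ
  refine ⟨B, hB, fun t ht0 ht ↦ ?_⟩
  have := h (Real.log t) ht
  rw [Real.exp_log ht0] at this
  rwa [zero_mul, sub_zero]

end Mertens

section PrimePowers

lemma sq_log_le {x : ℝ} (hx : 0 ≤ x) (hx1 : 1 ≤ x) : Real.log x ^ 2 ≤ 16 * x ^ (1 / 2 : ℝ) := by
  have h := Real.log_le_rpow_div hx (show (0 : ℝ) < 1 / 4 by norm_num)
  have h0 := Real.log_nonneg hx1
  calc Real.log x ^ 2 ≤ (x ^ (1 / 4 : ℝ) / (1 / 4)) ^ 2 := by gcongr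
    _ = 16 * (x ^ (1 / 4 : ℝ)) ^ (2 : ℕ) := by ring
    _ = _ := by rw [← Real.rpow_natCast, ← Real.rpow_mul hx]; norm_num

lemma injective_prime_pow_add_two :
    Function.Injective fun i : Nat.Primes × ℕ ↦ (i.1 : ℕ) ^ (i.2 + 2) := by
  rintro ⟨⟨p, hp⟩, k⟩ ⟨⟨r, hr⟩, l⟩ h
  have h : p ^ (k + 2) = r ^ (l + 2) := h
  have hpr : p = r :=
    (Nat.prime_dvd_prime_iff_eq hp hr).mp (hp.dvd_of_dvd_pow (h ▸ dvd_pow_self p (by omega)))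
  subst hpr
  have := Nat.pow_right_injective hp.two_le h
  exact Prod.ext rfl (show k = l by omega)

lemma summable_vonMangoldt_mul_log_nonprime :
    Summable fun n : ℕ ↦
      if n.Prime then 0 else ArithmeticFunction.vonMangoldt n * Real.log n / n := by
  rw [← injective_prime_pow_add_two.summable_iff]
  · have hs : Summable fun i : Nat.Primes × ℕ ↦
        (16 * ((i.1 : ℕ) : ℝ) ^ (-(3 / 2) : ℝ)) * (((i.2 : ℝ) + 2) * (1 / 2) ^ i.2) := by
      refine Summable.mul_of_nonneg (f := fun p : Nat.Primes ↦ 16 * ((p : ℕ) : ℝ) ^ (-(3 / 2) : ℝ))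
        (g := fun k : ℕ ↦ ((k : ℝ) + 2) * (1 / 2) ^ k) ?_ ?_ (fun p ↦ ?_) (fun k ↦ ?_)
      · exact (Nat.Primes.summable_rpow.mpr (by norm_num)).mul_left 16
      · have h1 := summable_pow_mul_geometric_of_norm_lt_one (R := ℝ) 1 (r := 1 / 2) (by norm_num)
        have h2 := (summable_geometric_of_lt_one (r := (1 / 2 : ℝ)) (by norm_num)
          (by norm_num)).mul_left 2
        refine (h1.add h2).congr fun k ↦ ?_
        ring
      · positivity
      · positivity
    refine hs.of_nonneg_of_le (fun i ↦ ?_) (fun ⟨⟨p, hp⟩, k⟩ ↦ ?_)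
    · dsimp only [Function.comp]
      split_ifs
      · rfl
      · exact div_nonneg (mul_nonneg ArithmeticFunction.vonMangoldt_nonneg
          (Real.log_natCast_nonneg _)) (Nat.cast_nonneg _)
    · have hp2 : (2 : ℝ) ≤ p := by exact_mod_cast hp.two_le
      have hp0 : (0 : ℝ) < p := by linarith
      have hnp : ¬ (p ^ (k + 2)).Prime := Nat.Prime.not_prime_pow (by omega)
      simp only [Function.comp, if_neg hnp]
      rw [ArithmeticFunction.vonMangoldt_apply_pow (by omega),
        ArithmeticFunction.vonMangoldt_apply_prime hp, Nat.cast_pow, Real.log_pow]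
      have h1 := sq_log_le hp0.le (by linarith)
      have h2 : (p : ℝ) ^ (-(3 / 2) : ℝ) = (p : ℝ) ^ (1 / 2 : ℝ) / (p : ℝ) ^ 2 := by
        rw [← Real.rpow_natCast, ← Real.rpow_sub hp0]
        norm_num
      have h3 : (2 : ℝ) ^ k ≤ (p : ℝ) ^ k := by gcongr
      rw [h2]
      calc Real.log p * (((k + 2 : ℕ) : ℝ) * Real.log p) / (p : ℝ) ^ (k + 2)
          = Real.log p ^ 2 / (p : ℝ) ^ 2 * ((k + 2) / (p : ℝ) ^ k) := by
            push_cast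
            rw [pow_add]
            field_simp
        _ ≤ 16 * (p : ℝ) ^ (1 / 2 : ℝ) / (p : ℝ) ^ 2 * ((k + 2) / 2 ^ k) := by gcongr
        _ = _ := by rw [one_div, inv_pow]; ring
  · intro n hn
    split_ifs with h
    · rfl
    · rw [ArithmeticFunction.vonMangoldt_eq_zero_iff.mpr, zero_mul, zero_div]
      intro hpp
      obtain ⟨p, k, hp, hk, rfl⟩ := (isPrimePow_nat_iff n).mp hpp
      refine hn ⟨(⟨p, hp⟩, k - 2), ?_⟩
      have : k ≠ 1 := by rintro rfl; exact h (by simpa using hp)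
      show p ^ (k - 2 + 2) = p ^ k
      congr 1
      omega

lemma hasSum_log_div_pow {p : ℕ} (hp : p.Prime) :
    HasSum (fun n : ℕ ↦ if n.primeFactors = {p} ∧ IsPrimePow n then
      ArithmeticFunction.vonMangoldt n / n else 0) (Real.log p / ((p : ℝ) - 1)) := by
  have hp2 : (2 : ℝ) ≤ p := by exact_mod_cast hp.two_le
  have hinj : Function.Injective fun k : ℕ ↦ p ^ (k + 1) := fun k l h ↦ by
    have := Nat.pow_right_injective hp.two_le h
    omega
  rw [← hinj.hasSum_iff]
  · have hg := (hasSum_geometric_of_lt_one (r := (p : ℝ)⁻¹) (by positivity)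
      (inv_lt_one_of_one_lt₀ (by linarith))).mul_left (Real.log p / p)
    have e1 : Real.log p / ((p : ℝ) - 1) = Real.log p / p * (1 - (p : ℝ)⁻¹)⁻¹ := by
      have : (p : ℝ) - 1 ≠ 0 := by linarith
      field_simp
    rw [e1]
    refine hg.congr_fun fun k ↦ ?_
    have hpk : IsPrimePow (p ^ (k + 1)) := hp.isPrimePow.pow k.succ_ne_zero
    simp only [Function.comp]
    rw [if_pos ⟨Nat.primeFactors_prime_pow (by omega) hp, hpk⟩,
      ArithmeticFunction.vonMangoldt_apply_pow (by omega),
      ArithmeticFunction.vonMangoldt_apply_prime hp, Nat.cast_pow, pow_succ, inv_pow]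
    field_simp
  · intro n hn
    rw [if_neg]
    rintro ⟨h, hpp⟩
    obtain ⟨r, k, hr, hk, rfl⟩ := (isPrimePow_nat_iff n).mp hpp
    rw [Nat.primeFactors_prime_pow hk.ne' hr, Finset.singleton_inj] at h
    subst h
    exact hn ⟨k - 1, by dsimp only; congr 1; omega⟩

lemma hasSum_vonMangoldt_not_coprime (q : ℕ) [NeZero q] :
    HasSum (fun n : ℕ ↦ if n.Coprime q then 0 else ArithmeticFunction.vonMangoldt n / (n : ℝ))
      (∑ p ∈ q.primeFactors, Real.log p / ((p : ℝ) - 1)) := by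
  have h := hasSum_sum (s := q.primeFactors) fun p hp ↦
    hasSum_log_div_pow (Nat.prime_of_mem_primeFactors hp)
  convert h using 1
  ext n
  by_cases hpp : IsPrimePow n
  · obtain ⟨r, k, hr, hk, rfl⟩ := (isPrimePow_nat_iff n).mp hpp
    have e : ∀ p, ((r ^ k).primeFactors = {p} ∧ IsPrimePow (r ^ k)) ↔ r = p := by
      intro p
      simp [hpp, Nat.primeFactors_prime_pow hk.ne' hr]
    simp_rw [e]
    rw [Finset.sum_ite_eq]
    have : (r ^ k).Coprime q ↔ r ∉ q.primeFactors := by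
      rw [Nat.coprime_pow_left_iff hk, hr.coprime_iff_not_dvd, Nat.mem_primeFactors]
      simp [hr, NeZero.ne q]
    by_cases hm : r ∈ q.primeFactors <;> simp [this, hm]
  · have := ArithmeticFunction.vonMangoldt_eq_zero_iff.mpr hpp
    simp [this]

end PrimePowers

section Coefficients

/-- On prime powers up to `y` and on primes beyond `y`, this is the value of a completely
multiplicative function which agrees with `χ` on primes `p ≤ y` not dividing `q`, is `1` on primes
dividing `q`, and is `-1`, `1`, `-1` on the primes of `(y, z₁]`, `(z₁, z₂]` and beyond `z₂`. -/
noncomputable def modelCoeff {q : ℕ} (χ : DirichletCharacter ℂ q) (y z₁ z₂ : ℝ) (n : ℕ) : ℂ :=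
  (if (n : ℝ) ≤ y then χ n + (if n.Coprime q then 0 else 1) + 1 else 0) -
    2 * (if (n : ℝ) ≤ z₁ then 1 else 0) + 2 * (if (n : ℝ) ≤ z₂ then 1 else 0) - 1

lemma norm_vonMangoldt_mul_le {b : ℕ → ℂ} {x : ℝ} (hb1 : b 1 = 1)
    (hbm : ∀ k n : ℕ, b (k * n) = b k * b n) (hb : ∀ p : ℕ, p.Prime → (p : ℝ) ≤ x → ‖b p‖ ≤ 1)
    {n : ℕ} (hn : (n : ℝ) ≤ x) :
    ‖(ArithmeticFunction.vonMangoldt n : ℂ) * b n‖ ≤ ArithmeticFunction.vonMangoldt n := by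
  rw [norm_mul, norm_real, Real.norm_of_nonneg ArithmeticFunction.vonMangoldt_nonneg]
  by_cases hpp : IsPrimePow n
  · obtain ⟨p, k, hp, hk, rfl⟩ := (isPrimePow_nat_iff n).mp hpp
    refine mul_le_of_le_one_right ArithmeticFunction.vonMangoldt_nonneg ?_
    let f : ℕ →* ℂ := ⟨⟨b, hb1⟩, hbm⟩
    have : b (p ^ k) = b p ^ k := map_pow f p k
    rw [this, norm_pow]
    refine pow_le_one₀ (norm_nonneg _) (hb p hp (le_trans ?_ hn))
    exact_mod_cast Nat.le_self_pow hk.ne' p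
  · simp [ArithmeticFunction.vonMangoldt_eq_zero_iff.mpr hpp]

variable {q : ℕ} {χ : DirichletCharacter ℂ q} {b : ℕ → ℂ} {x y z₁ z₂ : ℝ}

lemma norm_prime_le (hb : ∀ p : ℕ, p.Prime → (p ∣ q → b p = 1) ∧
      ((p : ℝ) ≤ y → ¬p ∣ q → b p = χ (p : ZMod q)) ∧ (y < (p : ℝ) → (p : ℝ) ≤ z₁ → b p = -1) ∧
      (z₁ < (p : ℝ) → (p : ℝ) ≤ z₂ → b p = 1) ∧ (z₂ < (p : ℝ) → (p : ℝ) ≤ x → b p = -1))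
    {p : ℕ} (hp : p.Prime) (hpx : (p : ℝ) ≤ x) : ‖b p‖ ≤ 1 := by
  obtain ⟨h1, h2, h3, h4, h5⟩ := hb p hp
  by_cases hpq : p ∣ q
  · simp [h1 hpq]
  rcases le_or_gt (p : ℝ) y with hy | hy
  · rw [h2 hy hpq]
    exact χ.norm_le_one _
  rcases le_or_gt (p : ℝ) z₁ with hz | hz
  · simp [h3 hy hz]
  rcases le_or_gt (p : ℝ) z₂ with hz' | hz'
  · simp [h4 hz hz']
  · simp [h5 hz' hpx]

lemma log_mul_norm_vonMangoldt_mul_sub_modelCoeff_le [NeZero q] (hqy : (q : ℝ) < y) (hy1 : 1 ≤ y)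
    (hyz : y ≤ z₁) (hzz : z₁ ≤ z₂)
    (hb1 : b 1 = 1) (hbm : ∀ k n : ℕ, b (k * n) = b k * b n)
    (hb : ∀ p : ℕ, p.Prime → (p ∣ q → b p = 1) ∧
      ((p : ℝ) ≤ y → ¬p ∣ q → b p = χ (p : ZMod q)) ∧ (y < (p : ℝ) → (p : ℝ) ≤ z₁ → b p = -1) ∧
      (z₁ < (p : ℝ) → (p : ℝ) ≤ z₂ → b p = 1) ∧ (z₂ < (p : ℝ) → (p : ℝ) ≤ x → b p = -1))
    {n : ℕ} (hn : (n : ℝ) ≤ x) :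
    Real.log y * ‖(ArithmeticFunction.vonMangoldt n : ℂ) * (b n - modelCoeff χ y z₁ z₂ n)‖ ≤
      2 * (if n.Prime then 0 else ArithmeticFunction.vonMangoldt n * Real.log n) := by
  have hR : 0 ≤ 2 * (if n.Prime then 0 else ArithmeticFunction.vonMangoldt n * Real.log n) := by
    have := mul_nonneg (ArithmeticFunction.vonMangoldt_nonneg (n := n)) (Real.log_natCast_nonneg n)
    split_ifs <;> linarith
  by_cases hpp : IsPrimePow n
  swap
  · simp [ArithmeticFunction.vonMangoldt_eq_zero_iff.mpr hpp]
  obtain ⟨p, k, hp, hk, rfl⟩ := (isPrimePow_nat_iff n).mp hpp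
  have hbk : b (p ^ k) = b p ^ k := map_pow (⟨⟨b, hb1⟩, hbm⟩ : ℕ →* ℂ) p k
  have hpn : (p : ℝ) ≤ (p ^ k : ℕ) := by exact_mod_cast Nat.le_self_pow hk.ne' p
  obtain ⟨h1, h2, h3, h4, h5⟩ := hb p hp
  rcases le_or_gt ((p ^ k : ℕ) : ℝ) y with hy | hy
  · have : b (p ^ k) = modelCoeff χ y z₁ z₂ (p ^ k) := by
      rw [modelCoeff, if_pos hy, if_pos (hy.trans hyz), if_pos (hy.trans (hyz.trans hzz)), hbk]
      by_cases hpq : p ∣ q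
      · have hc : ¬ (p ^ k).Coprime q := by
          rw [Nat.coprime_pow_left_iff hk, hp.coprime_iff_not_dvd]
          exact not_not.mpr hpq
        have hχ : χ ((p ^ k : ℕ) : ZMod q) = 0 :=
          χ.map_nonunit fun h ↦ hc ((ZMod.isUnit_iff_coprime _ _).mp h)
        rw [if_neg hc, hχ, h1 hpq]
        simp
      · have hc : (p ^ k).Coprime q := by
          rwa [Nat.coprime_pow_left_iff hk, hp.coprime_iff_not_dvd]
        rw [if_pos hc, h2 (hpn.trans hy) hpq, Nat.cast_pow, map_pow]
        ring
    rw [this, sub_self, mul_zero, norm_zero, mul_zero]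
    exact hR
  have hval : modelCoeff χ y z₁ z₂ (p ^ k) =
      if ((p ^ k : ℕ) : ℝ) ≤ z₁ then -1 else if ((p ^ k : ℕ) : ℝ) ≤ z₂ then 1 else -1 := by
    rw [modelCoeff, if_neg hy.not_ge]
    split_ifs with h h' h'
    · norm_num
    · exact absurd (h.trans hzz) h'
    · norm_num
    · norm_num
  by_cases hk1 : k = 1
  · subst hk1
    rw [pow_one] at *
    have hpq : ¬ p ∣ q := fun h ↦ by
      have : (p : ℝ) ≤ q := by exact_mod_cast Nat.le_of_dvd (NeZero.pos q) h
      linarith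
    have : b p = modelCoeff χ y z₁ z₂ p := by
      rw [hval]
      split_ifs with h h'
      · exact h3 hy h
      · exact h4 (not_le.mp h) h'
      · exact h5 (not_le.mp h') hn
    rw [this, sub_self, mul_zero, norm_zero, mul_zero]
    exact hR
  · have hnp : ¬ (p ^ k).Prime := Nat.Prime.not_prime_pow (by omega)
    rw [if_neg hnp, mul_sub]
    have hm : ‖modelCoeff χ y z₁ z₂ (p ^ k)‖ ≤ 1 := by
      rw [hval]
      split_ifs <;> simp
    have hΛ := ArithmeticFunction.vonMangoldt_nonneg (n := p ^ k)
    have h6 := norm_vonMangoldt_mul_le hb1 hbm (fun p hp hpx ↦ norm_prime_le hb hp hpx) hn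
    have h7 : ‖(ArithmeticFunction.vonMangoldt (p ^ k) : ℂ) * modelCoeff χ y z₁ z₂ (p ^ k)‖ ≤
        ArithmeticFunction.vonMangoldt (p ^ k) := by
      rw [norm_mul, norm_real, Real.norm_of_nonneg hΛ]
      exact mul_le_of_le_one_right hΛ hm
    have h8 := (norm_sub_le _ _).trans (add_le_add h6 h7)
    have h9 : Real.log y ≤ Real.log (p ^ k : ℕ) := Real.log_le_log (by linarith) hy.le
    have h10 := Real.log_nonneg hy1
    calc _ ≤ Real.log (p ^ k : ℕ) * (ArithmeticFunction.vonMangoldt (p ^ k) +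
          ArithmeticFunction.vonMangoldt (p ^ k)) := mul_le_mul h9 h8 (norm_nonneg _) (h10.trans h9)
      _ = _ := by ring

lemma sum_mul_modelCoeff (a : ℕ → ℂ) (hy : y ≤ x) (hz₁ : z₁ ≤ x) (hz₂ : z₂ ≤ x) :
    ∑ n ∈ Finset.Icc 1 ⌊x⌋₊, a n * modelCoeff χ y z₁ z₂ n =
      (∑ n ∈ Finset.Icc 1 ⌊y⌋₊, χ n * a n) +
      (∑ n ∈ Finset.Icc 1 ⌊y⌋₊, if n.Coprime q then 0 else a n) +
      (∑ n ∈ Finset.Icc 1 ⌊y⌋₊, a n) - 2 * (∑ n ∈ Finset.Icc 1 ⌊z₁⌋₊, a n) +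
      2 * (∑ n ∈ Finset.Icc 1 ⌊z₂⌋₊, a n) - ∑ n ∈ Finset.Icc 1 ⌊x⌋₊, a n := by
  have key : ∀ (t : ℝ) (f : ℕ → ℂ), t ≤ x → ∑ n ∈ Finset.Icc 1 ⌊t⌋₊, f n =
      ∑ n ∈ Finset.Icc 1 ⌊x⌋₊, if (n : ℝ) ≤ t then f n else 0 := by
    intro t f ht
    rw [← Finset.sum_filter]
    refine Finset.sum_congr ?_ fun _ _ ↦ rfl
    ext n
    simp only [Finset.mem_Icc, Finset.mem_filter]
    have := Nat.floor_le_floor ht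
    constructor
    · rintro ⟨h1, h2⟩
      exact ⟨⟨h1, h2.trans this⟩, (Nat.le_floor_iff' (by omega)).mp h2⟩
    · rintro ⟨⟨h1, -⟩, h2⟩
      exact ⟨h1, (Nat.le_floor_iff' (by omega)).mpr h2⟩
  rw [key y _ hy, key y _ hy, key y _ hy, key z₁ _ hz₁, key z₂ _ hz₂, Finset.mul_sum,
    Finset.mul_sum, ← Finset.sum_add_distrib, ← Finset.sum_add_distrib, ← Finset.sum_sub_distrib,
    ← Finset.sum_add_distrib, ← Finset.sum_sub_distrib]
  refine Finset.sum_congr rfl fun n _ ↦ ?_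
  rw [modelCoeff]
  split_ifs <;> ring

end Coefficients

section Approximation

variable {q : ℕ} {χ : DirichletCharacter ℂ q} {b : ℕ → ℂ} {x y z₁ z₂ : ℝ}

lemma norm_inv_cpow_one_add_sub_le {w : ℂ} {n : ℕ} (hn : 1 ≤ n) {L : ℝ} (hnL : Real.log n ≤ L)
    (hw : ‖w‖ * L ≤ 1) :
    ‖1 / (n : ℂ) ^ (1 + w) - (1 / n - w * (Real.log n / n))‖ ≤ (‖w‖ * L) ^ 2 / n := by
  have hn0 : (n : ℂ) ≠ 0 := by exact_mod_cast (by omega : n ≠ 0)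
  have h1 : ‖-(w * Real.log n)‖ ≤ ‖w‖ * L := by
    rw [norm_neg, norm_mul, norm_real, Real.norm_of_nonneg (Real.log_natCast_nonneg n)]
    gcongr
  have e : 1 / (n : ℂ) ^ (1 + w) - (1 / n - w * (Real.log n / n)) =
      (cexp (-(w * Real.log n)) - 1 - -(w * Real.log n)) / n := by
    rw [cpow_add _ _ hn0, cpow_one, cpow_def_of_ne_zero hn0, Complex.exp_neg, natCast_log,
      mul_comm w]
    field_simp
    ring
  rw [e, norm_div, norm_natCast]
  gcongr
  exact (Complex.norm_exp_sub_one_sub_id_le (h1.trans hw)).trans (by gcongr)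

lemma norm_sum_div_cpow_sub_le {a : ℕ → ℂ} {w : ℂ} (hx : 1 ≤ x) (hw : ‖w‖ * Real.log x ≤ 1)
    (ha : ∀ n : ℕ, (n : ℝ) ≤ x → ‖a n‖ ≤ ArithmeticFunction.vonMangoldt n) :
    ‖(∑ n ∈ Finset.Icc 1 ⌊x⌋₊, a n / (n : ℂ) ^ (1 + w)) -
      ((∑ n ∈ Finset.Icc 1 ⌊x⌋₊, a n / n) -
        w * ∑ n ∈ Finset.Icc 1 ⌊x⌋₊, a n / n * Real.log n)‖ ≤
      (‖w‖ * Real.log x) ^ 2 * ∑ n ∈ Finset.Icc 1 ⌊x⌋₊, ArithmeticFunction.vonMangoldt n / n := by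
  rw [Finset.mul_sum, Finset.mul_sum, ← Finset.sum_sub_distrib, ← Finset.sum_sub_distrib]
  refine norm_sum_le_of_le _ fun n hn ↦ ?_
  obtain ⟨h1, h2⟩ := Finset.mem_Icc.mp hn
  have hnx : (n : ℝ) ≤ x := (Nat.le_floor_iff (by linarith)).mp h2
  have h3 := norm_inv_cpow_one_add_sub_le h1
    (Real.log_le_log (by exact_mod_cast h1) hnx) hw
  have e : a n / (n : ℂ) ^ (1 + w) - (a n / n - w * (a n / n * Real.log n)) =
      a n * (1 / (n : ℂ) ^ (1 + w) - (1 / n - w * (Real.log n / n))) := by ring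
  rw [e, norm_mul]
  calc _ ≤ ArithmeticFunction.vonMangoldt n * ((‖w‖ * Real.log x) ^ 2 / n) :=
        mul_le_mul (ha n hnx) h3 (norm_nonneg _) ArithmeticFunction.vonMangoldt_nonneg
    _ = _ := by ring

/-- The sum of `Λ(n) log n / n` over the proper prime powers. -/
noncomputable def properPowerSum : ℝ :=
  ∑' n : ℕ, if n.Prime then 0 else ArithmeticFunction.vonMangoldt n * Real.log n / n

lemma nonprime_term_nonneg (n : ℕ) :
    0 ≤ if n.Prime then 0 else ArithmeticFunction.vonMangoldt n * Real.log n / n := by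
  split_ifs
  · rfl
  · exact div_nonneg (mul_nonneg ArithmeticFunction.vonMangoldt_nonneg
      (Real.log_natCast_nonneg _)) (Nat.cast_nonneg _)

lemma properPowerSum_nonneg : 0 ≤ properPowerSum := tsum_nonneg nonprime_term_nonneg

lemma sum_norm_vonMangoldt_sub_modelCoeff_le [NeZero q] (hqy : (q : ℝ) < y) (hy1 : 1 < y)
    (hyz : y ≤ z₁) (hzz : z₁ ≤ z₂) (hx : 0 ≤ x)
    (hb1 : b 1 = 1) (hbm : ∀ k n : ℕ, b (k * n) = b k * b n)
    (hb : ∀ p : ℕ, p.Prime → (p ∣ q → b p = 1) ∧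
      ((p : ℝ) ≤ y → ¬p ∣ q → b p = χ (p : ZMod q)) ∧ (y < (p : ℝ) → (p : ℝ) ≤ z₁ → b p = -1) ∧
      (z₁ < (p : ℝ) → (p : ℝ) ≤ z₂ → b p = 1) ∧ (z₂ < (p : ℝ) → (p : ℝ) ≤ x → b p = -1)) :
    ∑ n ∈ Finset.Icc 1 ⌊x⌋₊,
      ‖(ArithmeticFunction.vonMangoldt n : ℂ) * (b n - modelCoeff χ y z₁ z₂ n) / n‖ ≤
      2 * properPowerSum / Real.log y := by
  have hly : 0 < Real.log y := Real.log_pos hy1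
  calc _ ≤ ∑ n ∈ Finset.Icc 1 ⌊x⌋₊, 2 / Real.log y *
        (if n.Prime then 0 else ArithmeticFunction.vonMangoldt n * Real.log n / n) := by
        refine Finset.sum_le_sum fun n hn ↦ ?_
        have hnx : (n : ℝ) ≤ x := (Nat.le_floor_iff hx).mp (Finset.mem_Icc.mp hn).2
        have h := log_mul_norm_vonMangoldt_mul_sub_modelCoeff_le hqy hy1.le hyz hzz hb1 hbm hb hnx
        rw [norm_div, norm_natCast]
        have h2 : ‖(ArithmeticFunction.vonMangoldt n : ℂ) * (b n - modelCoeff χ y z₁ z₂ n)‖ ≤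
            2 * (if n.Prime then 0 else ArithmeticFunction.vonMangoldt n * Real.log n) /
              Real.log y := by
          rwa [le_div_iff₀' hly]
        refine (div_le_div_of_nonneg_right h2 n.cast_nonneg).trans (le_of_eq ?_)
        split_ifs <;> ring
    _ ≤ 2 / Real.log y * properPowerSum := by
        rw [← Finset.mul_sum]
        gcongr
        exact summable_vonMangoldt_mul_log_nonprime.sum_le_tsum _ fun n _ ↦ nonprime_term_nonneg n
    _ = _ := by ring

lemma abs_sum_not_coprime_sub_le (q : ℕ) [NeZero q] (hqy : (q : ℝ) < y) (hy1 : 1 < y) :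
    |(∑ n ∈ Finset.Icc 1 ⌊y⌋₊,
      if n.Coprime q then 0 else ArithmeticFunction.vonMangoldt n / (n : ℝ)) -
      ∑ p ∈ q.primeFactors, Real.log p / ((p : ℝ) - 1)| ≤ properPowerSum / Real.log y := by
  have hly : 0 < Real.log y := Real.log_pos hy1
  have h := hasSum_vonMangoldt_not_coprime q
  set f : ℕ → ℝ := fun n ↦ if n.Coprime q then 0 else ArithmeticFunction.vonMangoldt n / (n : ℝ)
    with hf
  have hf0 : ∀ n, 0 ≤ f n := fun n ↦ by
    simp only [hf]
    split_ifs
    · rfl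
    · exact div_nonneg ArithmeticFunction.vonMangoldt_nonneg n.cast_nonneg
  have h1 := sum_le_hasSum (Finset.Icc 1 ⌊y⌋₊) (fun n _ ↦ hf0 n) h
  have h2 : HasSum ((Finset.Icc 1 ⌊y⌋₊ : Set ℕ).indicator f) (∑ n ∈ Finset.Icc 1 ⌊y⌋₊, f n) := by
    rw [← Finset.sum_indicator_subset f (Finset.Subset.refl _)]
    exact hasSum_sum_of_ne_finset_zero fun n hn ↦ Set.indicator_of_notMem (by simpa using hn) f
  have h3 := hasSum_le (fun n ↦ ?_) h (h2.add
    (summable_vonMangoldt_mul_log_nonprime.hasSum.mul_left (1 / Real.log y)))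
  · rw [abs_sub_comm, abs_of_nonneg (by linarith)]
    have : properPowerSum / Real.log y = 1 / Real.log y * ∑' n : ℕ, if n.Prime then 0 else
      ArithmeticFunction.vonMangoldt n * Real.log n / n := by rw [properPowerSum]; ring
    linarith
  · have hnn := mul_nonneg (one_div_nonneg.mpr hly.le) (nonprime_term_nonneg n)
    by_cases hn : n ∈ Finset.Icc 1 ⌊y⌋₊
    · rw [Set.indicator_of_mem (by simpa using hn)]
      linarith
    · rw [Set.indicator_of_notMem (by simpa using hn), zero_add]
      by_cases hc : n.Coprime q
      · simp only [hf, if_pos hc]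
        exact hnn
      rcases Nat.eq_zero_or_pos n with h0 | h0
      · simp [hf, h0]
      have hyn : y < n := by
        refine (Nat.floor_lt (by linarith)).mp ?_
        simp only [Finset.mem_Icc, not_and, not_le] at hn
        exact hn h0
      have hp : ¬ n.Prime := fun hp ↦ by
        have hd : n ∣ q := by
          by_contra hd
          exact hc (hp.coprime_iff_not_dvd.mpr hd)
        have : (n : ℝ) ≤ q := by exact_mod_cast Nat.le_of_dvd (NeZero.pos q) hd
        linarith
      simp only [hf, if_neg hc, if_neg hp]
      have hl : Real.log y ≤ Real.log n := Real.log_le_log (by linarith) hyn.le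
      rw [one_div, ← div_eq_inv_mul, le_div_iff₀ hly, div_mul_eq_mul_div]
      have := ArithmeticFunction.vonMangoldt_nonneg (n := n)
      gcongr

end Approximation

section Assembly

variable {q : ℕ} {χ : DirichletCharacter ℂ q} {b : ℕ → ℂ} {x y z₁ z₂ : ℝ}

lemma norm_combination_sub_le {g h f₁ f₂ f₃ f₄ g' h' f₁' f₂' f₃' f₄' : ℂ} {eg eh e : ℝ}
    (hg : ‖g - g'‖ ≤ eg) (hh : ‖h - h'‖ ≤ eh) (h₁ : ‖f₁ - f₁'‖ ≤ e) (h₂ : ‖f₂ - f₂'‖ ≤ e)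
    (h₃ : ‖f₃ - f₃'‖ ≤ e) (h₄ : ‖f₄ - f₄'‖ ≤ e) :
    ‖(g + h + f₁ - 2 * f₂ + 2 * f₃ - f₄) - (g' + h' + f₁' - 2 * f₂' + 2 * f₃' - f₄')‖ ≤
      eg + eh + 6 * e := by
  have e0 : (g + h + f₁ - 2 * f₂ + 2 * f₃ - f₄) - (g' + h' + f₁' - 2 * f₂' + 2 * f₃' - f₄') =
      (g - g') + (h - h') + (f₁ - f₁') - 2 * (f₂ - f₂') + 2 * (f₃ - f₃') - (f₄ - f₄') := by ring
  rw [e0]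
  have n2 : ∀ z : ℂ, ‖2 * z‖ = 2 * ‖z‖ := fun z ↦ by simp
  have t1 := norm_sub_le ((g - g') + (h - h') + (f₁ - f₁') - 2 * (f₂ - f₂') + 2 * (f₃ - f₃'))
    (f₄ - f₄')
  have t2 := norm_add_le ((g - g') + (h - h') + (f₁ - f₁') - 2 * (f₂ - f₂')) (2 * (f₃ - f₃'))
  have t3 := norm_sub_le ((g - g') + (h - h') + (f₁ - f₁')) (2 * (f₂ - f₂'))
  have t4 := norm_add₃_le (a := g - g') (b := h - h') (c := f₁ - f₁')
  rw [n2] at t2 t3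
  linarith

/-- Asymptotics of `∑ Λ(n) b(n) / n` and `∑ Λ(n) b(n) log n / n` for a completely multiplicative
`b` whose values at primes are those of `modelCoeff`. -/
lemma exists_sum_vonMangoldt_mul_bound [NeZero q] (χ : DirichletCharacter ℂ q) (hχ : χ ≠ 1) :
    ∃ C : ℝ, 0 ≤ C ∧ ∀ (b : ℕ → ℂ) (x y z₁ z₂ : ℝ), 3 ≤ Real.log y → (q : ℝ) < y → 1 < y →
      y ≤ z₁ → z₁ ≤ z₂ → z₂ ≤ x → b 1 = 1 → (∀ k n : ℕ, b (k * n) = b k * b n) →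
      (∀ p : ℕ, p.Prime → (p ∣ q → b p = 1) ∧
        ((p : ℝ) ≤ y → ¬p ∣ q → b p = χ (p : ZMod q)) ∧ (y < (p : ℝ) → (p : ℝ) ≤ z₁ → b p = -1) ∧
        (z₁ < (p : ℝ) → (p : ℝ) ≤ z₂ → b p = 1) ∧ (z₂ < (p : ℝ) → (p : ℝ) ≤ x → b p = -1)) →
      ‖(∑ n ∈ Finset.Icc 1 ⌊x⌋₊, (ArithmeticFunction.vonMangoldt n : ℂ) * b n / n) -
        (-(deriv (LFunction χ) 1 / LFunction χ 1) +
          ((∑ p ∈ q.primeFactors, Real.log p / ((p : ℝ) - 1) : ℝ) : ℂ) +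
          ((Real.log y - 2 * Real.log z₁ + 2 * Real.log z₂ - Real.log x : ℝ) : ℂ))‖ ≤
        C / Real.log y ∧
      ‖(∑ n ∈ Finset.Icc 1 ⌊x⌋₊, (ArithmeticFunction.vonMangoldt n : ℂ) * b n / n * Real.log n) -
        (((Real.log y ^ 2 - 2 * Real.log z₁ ^ 2 + 2 * Real.log z₂ ^ 2 - Real.log x ^ 2) / 2 : ℝ) :
          ℂ)‖ ≤ C * Real.log x * (1 + Real.log x / Real.log y) := by
  obtain ⟨c, B₀, hB₀, h0⟩ := exists_mertens
  obtain ⟨B₁, hB₁, h1⟩ := exists_mertens_character χ hχ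
  obtain ⟨B₂, hB₂, h2⟩ := exists_sum_mul_log_bound h0
  obtain ⟨B₃, hB₃, h3⟩ := exists_sum_mul_log_bound h1
  set ℓ := -(deriv (LFunction χ) 1 / LFunction χ 1)
  set P := ∑ p ∈ q.primeFactors, Real.log p / ((p : ℝ) - 1)
  have hT := properPowerSum_nonneg
  set T := properPowerSum
  have hP : 0 ≤ P := (hasSum_vonMangoldt_not_coprime q).nonneg fun n ↦ by
    split_ifs
    · rfl
    · exact div_nonneg ArithmeticFunction.vonMangoldt_nonneg n.cast_nonneg
  refine ⟨3 * T + B₁ + 6 * B₀ + B₃ + P + 6 * B₂, by positivity,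
    fun b x y z₁ z₂ hly hqy hy1 hyz hzz hzx hb1 hbm hb ↦ ?_⟩
  have hy0 : 0 < y := by linarith
  have l1 : Real.log y ≤ Real.log z₁ := Real.log_le_log hy0 hyz
  have l2 : Real.log z₁ ≤ Real.log z₂ := Real.log_le_log (by linarith) hzz
  have l3 : Real.log z₂ ≤ Real.log x := Real.log_le_log (by linarith) hzx
  have hlx : 0 < Real.log x := by linarith
  have hly0 : 0 < Real.log y := by linarith
  have herr := sum_norm_vonMangoldt_sub_modelCoeff_le hqy hy1 hyz hzz
    (by linarith : 0 ≤ x) hb1 hbm hb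
  have hnc := abs_sum_not_coprime_sub_le q hqy hy1
  have hF0 : ∀ t, Real.log y ≤ Real.log t → 0 < t →
      ‖(∑ n ∈ Finset.Icc 1 ⌊t⌋₊, (ArithmeticFunction.vonMangoldt n : ℂ) / n) -
        (Real.log t + c)‖ ≤ B₀ / Real.log y := fun t ht ht0 ↦ by
    have := h0 t ht0 (by linarith)
    rw [one_mul, sub_sub] at this
    exact this.trans (by gcongr)
  have hF1 : ∀ t, 1 ≤ t → Real.log t ≤ Real.log x →
      ‖(∑ n ∈ Finset.Icc 1 ⌊t⌋₊, (ArithmeticFunction.vonMangoldt n : ℂ) / n * Real.log n) -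
        (Real.log t : ℂ) ^ 2 / 2‖ ≤ B₂ * Real.log x := fun t ht ht0 ↦ by
    have := h2 t ht
    rw [one_mul] at this
    exact this.trans (by gcongr)
  constructor
  · have hm := sum_mul_modelCoeff (χ := χ) (y := y) (z₁ := z₁) (z₂ := z₂) (x := x)
      (fun n ↦ (ArithmeticFunction.vonMangoldt n : ℂ) / n) (by linarith) (by linarith) hzx
    have hg : ‖(∑ n ∈ Finset.Icc 1 ⌊y⌋₊, χ n * ((ArithmeticFunction.vonMangoldt n : ℂ) / n)) - ℓ‖
        ≤ B₁ / Real.log y := by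
      have := h1 y hy0 hly
      simp_rw [mul_div_assoc] at this
      rwa [zero_mul, sub_zero] at this
    have hh : ‖(∑ n ∈ Finset.Icc 1 ⌊y⌋₊,
        if n.Coprime q then 0 else (ArithmeticFunction.vonMangoldt n : ℂ) / n) - (P : ℂ)‖ ≤
        T / Real.log y := by
      have e : (∑ n ∈ Finset.Icc 1 ⌊y⌋₊,
          if n.Coprime q then 0 else (ArithmeticFunction.vonMangoldt n : ℂ) / n) =
          ((∑ n ∈ Finset.Icc 1 ⌊y⌋₊,
            if n.Coprime q then 0 else ArithmeticFunction.vonMangoldt n / n : ℝ) : ℂ) := by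
        rw [ofReal_sum]
        refine Finset.sum_congr rfl fun n _ ↦ ?_
        split_ifs <;> simp
      rw [e, ← ofReal_sub, norm_real, Real.norm_eq_abs]
      exact hnc
    have hc := norm_combination_sub_le hg hh (hF0 y le_rfl hy0) (hF0 z₁ l1 (by linarith))
      (hF0 z₂ (by linarith) (by linarith)) (hF0 x (by linarith) (by linarith))
    rw [← hm] at hc
    have hd : ‖(∑ n ∈ Finset.Icc 1 ⌊x⌋₊, (ArithmeticFunction.vonMangoldt n : ℂ) * b n / n) -
        ∑ n ∈ Finset.Icc 1 ⌊x⌋₊, (ArithmeticFunction.vonMangoldt n : ℂ) / n *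
          modelCoeff χ y z₁ z₂ n‖ ≤ 2 * T / Real.log y := by
      refine le_trans ?_ herr
      rw [← Finset.sum_sub_distrib]
      refine (norm_sum_le _ _).trans (le_of_eq (Finset.sum_congr rfl fun n _ ↦ ?_))
      congr 1
      ring
    have hs := norm_add_le_of_le hd hc
    rw [sub_add_sub_cancel] at hs
    have e : ℓ + P + ((Real.log y - 2 * Real.log z₁ + 2 * Real.log z₂ - Real.log x : ℝ) : ℂ) =
        ℓ + P + (Real.log y + c) - 2 * (Real.log z₁ + c) + 2 * (Real.log z₂ + c) -
          (Real.log x + c) := by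
      push_cast
      ring
    rw [e]
    refine hs.trans ?_
    have : 2 * T / Real.log y + (B₁ / Real.log y + T / Real.log y + 6 * (B₀ / Real.log y)) =
        (3 * T + B₁ + 6 * B₀) / Real.log y := by ring
    rw [this]
    refine div_le_div_of_nonneg_right ?_ hly0.le
    linarith
  · have hm := sum_mul_modelCoeff (χ := χ) (y := y) (z₁ := z₁) (z₂ := z₂) (x := x)
      (fun n ↦ (ArithmeticFunction.vonMangoldt n : ℂ) / n * Real.log n)
      (by linarith) (by linarith) hzx
    have hg : ‖(∑ n ∈ Finset.Icc 1 ⌊y⌋₊, χ n * ((ArithmeticFunction.vonMangoldt n : ℂ) / n *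
        Real.log n)) - 0‖ ≤ B₃ * Real.log x := by
      have := h3 y hy1.le
      rw [zero_mul, zero_div] at this
      simp_rw [← mul_assoc, ← mul_div_assoc]
      exact this.trans (by gcongr; linarith)
    have hh : ‖(∑ n ∈ Finset.Icc 1 ⌊y⌋₊, if n.Coprime q then 0 else
        (ArithmeticFunction.vonMangoldt n : ℂ) / n * Real.log n) - 0‖ ≤ P * Real.log x := by
      rw [sub_zero]
      have hle := sum_le_hasSum (Finset.Icc 1 ⌊y⌋₊) (fun n _ ↦ by
        split_ifs
        · rfl
        · exact div_nonneg ArithmeticFunction.vonMangoldt_nonneg n.cast_nonneg)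
        (hasSum_vonMangoldt_not_coprime q)
      refine le_trans ?_ (mul_le_mul_of_nonneg_right hle hlx.le)
      rw [Finset.sum_mul]
      refine norm_sum_le_of_le _ fun n hn ↦ ?_
      obtain ⟨hn1, hn2⟩ := Finset.mem_Icc.mp hn
      split_ifs
      · simp
      · rw [norm_mul, norm_div, Complex.norm_natCast, norm_real, norm_real,
          Real.norm_of_nonneg ArithmeticFunction.vonMangoldt_nonneg,
          Real.norm_of_nonneg (Real.log_natCast_nonneg n)]
        have := ArithmeticFunction.vonMangoldt_nonneg (n := n)
        have hnx : (n : ℝ) ≤ x := ((Nat.le_floor_iff hy0.le).mp hn2).trans (by linarith)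
        have : Real.log n ≤ Real.log x := Real.log_le_log (by exact_mod_cast hn1) hnx
        gcongr
    have hc := norm_combination_sub_le hg hh (hF1 y hy1.le (by linarith))
      (hF1 z₁ (by linarith) (by linarith))
      (hF1 z₂ (by linarith) (by linarith)) (hF1 x (by linarith) le_rfl)
    rw [← hm] at hc
    have hd : ‖(∑ n ∈ Finset.Icc 1 ⌊x⌋₊,
        (ArithmeticFunction.vonMangoldt n : ℂ) * b n / n * Real.log n) -
        ∑ n ∈ Finset.Icc 1 ⌊x⌋₊, (ArithmeticFunction.vonMangoldt n : ℂ) / n * Real.log n *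
          modelCoeff χ y z₁ z₂ n‖ ≤ 2 * T / Real.log y * Real.log x := by
      refine le_trans ?_ (mul_le_mul_of_nonneg_right herr hlx.le)
      rw [← Finset.sum_sub_distrib, Finset.sum_mul]
      refine norm_sum_le_of_le _ fun n hn ↦ ?_
      obtain ⟨hn1, hn2⟩ := Finset.mem_Icc.mp hn
      have hnx : (n : ℝ) ≤ x := (Nat.le_floor_iff (by linarith)).mp hn2
      have : Real.log n ≤ Real.log x := Real.log_le_log (by exact_mod_cast hn1) hnx
      calc _ = ‖(ArithmeticFunction.vonMangoldt n : ℂ) * (b n - modelCoeff χ y z₁ z₂ n) / n *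
            Real.log n‖ := by congr 1; ring
        _ = _ := norm_mul _ _
        _ ≤ _ := by
          rw [norm_real, Real.norm_of_nonneg (Real.log_natCast_nonneg n)]
          gcongr
    have hs := norm_add_le_of_le hd hc
    rw [sub_add_sub_cancel] at hs
    have e : (((Real.log y ^ 2 - 2 * Real.log z₁ ^ 2 + 2 * Real.log z₂ ^ 2 - Real.log x ^ 2) / 2 :
        ℝ) : ℂ) = 0 + 0 + (Real.log y : ℂ) ^ 2 / 2 - 2 * ((Real.log z₁ : ℂ) ^ 2 / 2) +
        2 * ((Real.log z₂ : ℂ) ^ 2 / 2) - (Real.log x : ℂ) ^ 2 / 2 := by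
      push_cast
      ring
    rw [e]
    refine hs.trans ?_
    have hr : 1 ≤ Real.log x / Real.log y := by rw [le_div_iff₀ hly0]; linarith
    have hr2 : 2 * T / Real.log y * Real.log x ≤
        (3 * T + B₁ + 6 * B₀) * Real.log x * (Real.log x / Real.log y) := by
      calc _ = 2 * T * 1 * (Real.log x / Real.log y) := by ring
        _ ≤ (3 * T + B₁ + 6 * B₀) * Real.log x * (Real.log x / Real.log y) := by
          exact mul_le_mul_of_nonneg_right
            (mul_le_mul (by linarith) (by linarith) zero_le_one (by positivity)) (by positivity)
    have hr3 : 0 ≤ (3 * T + B₁ + 6 * B₀) * Real.log x := by positivity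
    have hr4 : 0 ≤ (B₃ + P + 6 * B₂) * Real.log x * (Real.log x / Real.log y) := by positivity
    nlinarith

end Assembly

lemma exists_sum_vonMangoldt_div_le :
    ∃ D : ℝ, 0 ≤ D ∧ ∀ x : ℝ, 0 < x → 3 ≤ Real.log x →
      ∑ n ∈ Finset.Icc 1 ⌊x⌋₊, ArithmeticFunction.vonMangoldt n / n ≤ D * Real.log x := by
  obtain ⟨c, B, hB, h⟩ := exists_mertens
  refine ⟨1 + ‖c‖ + B, by positivity, fun x hx hlx ↦ ?_⟩
  have h' := h x hx hlx
  have e : (∑ n ∈ Finset.Icc 1 ⌊x⌋₊, (ArithmeticFunction.vonMangoldt n : ℂ) / n) =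
      ((∑ n ∈ Finset.Icc 1 ⌊x⌋₊, ArithmeticFunction.vonMangoldt n / n : ℝ) : ℂ) := by
    rw [ofReal_sum]
    exact Finset.sum_congr rfl fun n _ ↦ by simp
  have h2 := norm_add_le_of_le h' (norm_add_le (1 * (Real.log x : ℂ)) c)
  rw [sub_sub, sub_add_cancel, e, norm_real, one_mul, norm_real,
    Real.norm_of_nonneg (by linarith : 0 ≤ Real.log x)] at h2
  have h3 : B / Real.log x ≤ B := div_le_self hB (by linarith)
  have h4 := norm_nonneg c
  refine (Real.le_norm_self _).trans (h2.trans ?_)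
  nlinarith

lemma norm_linear_expansion_sub_le {A₀ A₁ S E W T : ℂ} {L l Δ ε C K D : ℝ} (hL : 1 ≤ L)
    (hl : 0 ≤ l) (hε : 0 < ε) (hK : ‖W‖ ≤ K)
    (hA₀ : ‖A₀ - (S + ((-2 * l : ℝ) : ℂ))‖ ≤ C / (ε * L))
    (hA₁ : ‖A₁ - (((L ^ 2 * Δ - 4 * ε * L * l - 2 * l ^ 2) / 2 : ℝ) : ℂ)‖ ≤
      C * L * (1 + L / (ε * L)))
    (hE : ‖E - (A₀ - W / (L : ℂ) ^ 2 * A₁)‖ ≤ K ^ 2 * D / L)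
    (hT : S - 2 * l - W * Δ / 2 = T) :
    ‖E - T‖ ≤ (C / ε + K * C * (1 + 1 / ε) + K ^ 2 * D + K * (2 * ε * l + l ^ 2)) / L := by
  have hL0 : 0 < L := by linarith
  have hLc : (L : ℂ) ≠ 0 := by exact_mod_cast hL0.ne'
  have e : E - T = (E - (A₀ - W / (L : ℂ) ^ 2 * A₁)) + (A₀ - (S + ((-2 * l : ℝ) : ℂ))) -
      W / (L : ℂ) ^ 2 * (A₁ - (((L ^ 2 * Δ - 4 * ε * L * l - 2 * l ^ 2) / 2 : ℝ) : ℂ)) +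
      W * ((2 * ε * l / L + l ^ 2 / L ^ 2 : ℝ) : ℂ) := by
    rw [← hT]
    push_cast
    field_simp
    ring
  have hW0 := norm_nonneg W
  have hK0 : 0 ≤ K := hW0.trans hK
  have n1 : ‖W / (L : ℂ) ^ 2 * (A₁ - (((L ^ 2 * Δ - 4 * ε * L * l - 2 * l ^ 2) / 2 : ℝ) : ℂ))‖ ≤
      K * C * (1 + 1 / ε) / L := by
    rw [norm_mul, norm_div, norm_pow, norm_real, Real.norm_of_nonneg hL0.le]
    calc _ ≤ K / L ^ 2 * (C * L * (1 + L / (ε * L))) := by gcongr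
      _ = _ := by field_simp
  have n2 : ‖W * ((2 * ε * l / L + l ^ 2 / L ^ 2 : ℝ) : ℂ)‖ ≤ K * (2 * ε * l + l ^ 2) / L := by
    rw [norm_mul, norm_real, Real.norm_of_nonneg (by positivity)]
    calc _ ≤ K * (2 * ε * l / L + l ^ 2 / L) := by
          gcongr
          nlinarith
      _ = _ := by ring
  rw [e]
  refine (norm_add_le_of_le (norm_sub_le_of_le (norm_add_le_of_le hE hA₀) n1) n2).trans
    (le_of_eq ?_)
  field_simp
  ring

lemma ne_one_of_conj_isPrimitive {q : ℕ} [NeZero q] (hq : 2 < q) {χ χbar : DirichletCharacter ℂ q}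
    (hχ : χ.IsPrimitive) (hχbar : ∀ a : ZMod q, χbar a = starRingEnd ℂ (χ a)) : χbar ≠ 1 := by
  rintro rfl
  have h1 : χ = 1 := by
    ext a
    have := hχbar a
    rw [MulChar.one_apply_coe] at this ⊢
    rw [← Complex.conj_conj (χ a), ← this, map_one]
  rw [h1, DirichletCharacter.IsPrimitive, DirichletCharacter.conductor_one] at hχ
  omega

/-- On the circle `𝒞₁ = {1 + (c₁ + ic₂)/(log x)² + c₁ e^{iφ}/(4 (log x)²)}` one has
`W_x(s(φ)) = (S₁ + (|S₁| + 1/4) e^{iφ})/2 + O(1/log x)`; in particular `|W_x| ≍ 1` there. -/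
theorem W_x_on_circle (q : ℕ) [NeZero q] (hq : 2 < q)
    (χ : DirichletCharacter ℂ q) (hχ : χ.IsPrimitive)
    (χbar : DirichletCharacter ℂ q) (hχbar : ∀ a : ZMod q, χbar a = starRingEnd ℂ (χ a))
    (δ : ℝ) (hδ : 1 / 2 < δ) (hδ' : δ < 1) (ε : ℝ) (hε : ε = 2 * δ - 1)
    (S₁ : ℂ) (hS₁ : S₁ = -(deriv (LFunction χbar) 1 / LFunction χbar 1) +
      ((∑ p ∈ q.primeFactors, Real.log p / ((p : ℝ) - 1) : ℝ) : ℂ))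
    (m : ℝ) (hm1 : 1 < m) (hm : 4 * Real.log m = S₁.re + 4 * ‖S₁‖ + 1)
    (c₁ c₂ : ℝ) (hc₁ : c₁ = (4 * ‖S₁‖ + 1) / |2 * δ ^ 2 - 1 - ε ^ 2|)
    (hc₂ : c₂ = -S₁.im / |2 * δ ^ 2 - 1 - ε ^ 2|) :
    ∃ C : ℝ, 0 < C ∧ ∃ x₀ : ℝ,
      ∀ x : ℝ, x₀ ≤ x → (q : ℝ) < x ^ ε → 2 * Real.log m / (1 - ε) < Real.log x →
        ∀ b : ℕ → ℂ, b 1 = 1 → (∀ k n : ℕ, b (k * n) = b k * b n) →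
          (∀ p : ℕ, p.Prime →
            (p ∣ q → b p = 1) ∧
            ((p : ℝ) ≤ x ^ ε → ¬p ∣ q → b p = χbar (p : ZMod q)) ∧
            (x ^ ε < (p : ℝ) → (p : ℝ) ≤ m * x ^ ε → b p = -1) ∧
            (m * x ^ ε < (p : ℝ) → (p : ℝ) ≤ x ^ δ → b p = 1) ∧
            (x ^ δ < (p : ℝ) → (p : ℝ) ≤ x → b p = -1)) →
          ∀ φ : ℝ, 0 ≤ φ → φ ≤ 2 * Real.pi →
            ‖(∑ n ∈ Finset.Icc 1 ⌊x⌋₊,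
                  (ArithmeticFunction.vonMangoldt n : ℂ) * b n /
                    (n : ℂ) ^ (1 + ((c₁ : ℂ) + (c₂ : ℂ) * I) / (Real.log x : ℂ) ^ 2 +
                      (c₁ : ℂ) * Complex.exp (φ * I) / (4 * (Real.log x : ℂ) ^ 2))) -
                (S₁ + ((‖S₁‖ : ℂ) + 1 / 4) * Complex.exp (φ * I)) / 2‖ ≤
              C / Real.log x := by
  have hε0 : 0 < ε := by linarith
  set Δ := 2 * δ ^ 2 - 1 - ε ^ 2 with hΔ
  have hΔneg : Δ < 0 := by
    rw [hΔ, hε]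
    nlinarith [mul_pos (sub_pos.mpr hδ') (sub_pos.mpr hδ')]
  have hl : 0 < Real.log m := Real.log_pos hm1
  have hc₁0 : 0 ≤ c₁ := by rw [hc₁]; positivity
  have hc₁Δ : c₁ * -Δ = 4 * ‖S₁‖ + 1 := by
    rw [hc₁, abs_of_neg hΔneg, div_mul_cancel₀ _ (by linarith)]
  have hc₂Δ : c₂ * -Δ = -S₁.im := by
    rw [hc₂, abs_of_neg hΔneg, div_mul_cancel₀ _ (by linarith)]
  obtain ⟨C₁, hC₁, hsum⟩ :=
    exists_sum_vonMangoldt_mul_bound χbar (ne_one_of_conj_isPrimitive hq hχ hχbar)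
  obtain ⟨D, hD, hΛ⟩ := exists_sum_vonMangoldt_div_le
  set K := 5 / 4 * c₁ + |c₂| with hK
  have hK0 : 0 ≤ K := by positivity
  refine ⟨C₁ / ε + K * C₁ * (1 + 1 / ε) + K ^ 2 * D +
    K * (2 * ε * Real.log m + Real.log m ^ 2) + 1, by positivity,
    Real.exp (3 / ε + K + 3), fun x hx hqx hmx b hb1 hbm hb φ _ _ ↦ ?_⟩
  have hx0 : 0 < x := (Real.exp_pos _).trans_le hx
  have hLx : 3 / ε + K + 3 ≤ Real.log x := (Real.le_log_iff_exp_le hx0).mpr hx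
  have h3ε : 0 < 3 / ε := by positivity
  set L := Real.log x with hL
  have hεL : 3 ≤ ε * L := by
    have : 3 / ε ≤ L := by linarith
    rwa [div_le_iff₀ hε0, mul_comm] at this
  have hx1 : 1 ≤ x := by
    by_contra! h
    linarith [Real.log_nonpos hx0.le h.le]
  have hly : Real.log (x ^ ε) = ε * L := Real.log_rpow hx0 ε
  have hlz₂ : Real.log (x ^ δ) = δ * L := Real.log_rpow hx0 δ
  have hy0 : 0 < x ^ ε := Real.rpow_pos_of_pos hx0 ε
  have hlz₁ : Real.log (m * x ^ ε) = Real.log m + ε * L := by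
    rw [Real.log_mul (by linarith) hy0.ne', hly]
  have hy1 : 1 < x ^ ε := Real.one_lt_rpow (by
    by_contra! h
    linarith [Real.log_nonpos hx0.le h]) hε0
  have hzz : m * x ^ ε ≤ x ^ δ := by
    rw [← Real.log_le_log_iff (by positivity) (Real.rpow_pos_of_pos hx0 δ), hlz₁, hlz₂]
    rw [div_lt_iff₀ (by linarith)] at hmx
    have : δ = ε + (1 - ε) / 2 := by linarith
    rw [this]
    linarith
  obtain ⟨hA₀, hA₁⟩ := hsum b x (x ^ ε) (m * x ^ ε) (x ^ δ) (by rwa [hly]) hqx hy1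
    (le_mul_of_one_le_left hy0.le hm1.le) hzz (Real.rpow_le_self_of_one_le hx1 hδ'.le) hb1 hbm hb
  rw [hly, hlz₁, hlz₂, ← hS₁, ← hL] at hA₀
  rw [hly, hlz₁, hlz₂, ← hL] at hA₁
  have e₀ : ε * L - 2 * (Real.log m + ε * L) + 2 * (δ * L) - L = -2 * Real.log m := by
    rw [hε]; ring
  have e₁ : (ε * L) ^ 2 - 2 * (Real.log m + ε * L) ^ 2 + 2 * (δ * L) ^ 2 - L ^ 2 =
      L ^ 2 * Δ - 4 * ε * L * Real.log m - 2 * Real.log m ^ 2 := by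
    rw [hΔ]; ring
  rw [e₀] at hA₀
  rw [e₁] at hA₁
  set W : ℂ := c₁ + c₂ * I + c₁ * Complex.exp (φ * I) / 4 with hW
  have hWK : ‖W‖ ≤ K := by
    refine (norm_add₃_le).trans (le_of_eq ?_)
    rw [norm_div, norm_mul, norm_mul, Complex.norm_exp_ofReal_mul_I, norm_I, norm_real, norm_real,
      Real.norm_of_nonneg hc₁0, Real.norm_eq_abs, hK]
    norm_num
    ring
  have hL0 : 0 < L := by linarith
  have hW2 : ‖W / (L : ℂ) ^ 2‖ = ‖W‖ / L ^ 2 := by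
    rw [norm_div, norm_pow, norm_real, Real.norm_of_nonneg hL0.le]
  have hwL : ‖W / (L : ℂ) ^ 2‖ * L = ‖W‖ / L := by
    rw [hW2]; field_simp
  have hE := norm_sum_div_cpow_sub_le (x := x) (w := W / (L : ℂ) ^ 2)
    (a := fun n ↦ (ArithmeticFunction.vonMangoldt n : ℂ) * b n) hx1
    (by rw [← hL, hwL, div_le_one hL0]; linarith)
    (fun n hn ↦ norm_vonMangoldt_mul_le hb1 hbm (fun p hp hpx ↦ norm_prime_le hb hp hpx) hn)
  have hs : 1 + ((c₁ : ℂ) + (c₂ : ℂ) * I) / (L : ℂ) ^ 2 +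
      (c₁ : ℂ) * Complex.exp (φ * I) / (4 * (L : ℂ) ^ 2) = 1 + W / (L : ℂ) ^ 2 := by
    rw [hW]; ring
  rw [hs]
  have hE' := hE.trans (show _ ≤ K ^ 2 * D / L by
    rw [← hL, hwL]
    calc _ ≤ (K / L) ^ 2 * (D * L) := by
          gcongr
          exact hΛ x hx0 (by linarith)
      _ = _ := by field_simp)
  have hT : S₁ - 2 * Real.log m - W * Δ / 2 =
      (S₁ + ((‖S₁‖ : ℂ) + 1 / 4) * Complex.exp (φ * I)) / 2 := by
    have h1 : (c₁ : ℂ) * -Δ = 4 * ‖S₁‖ + 1 := by exact_mod_cast hc₁Δ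
    have h2 : (c₂ : ℂ) * -Δ = -S₁.im := by exact_mod_cast hc₂Δ
    have h3 : 4 * (Real.log m : ℂ) = S₁.re + 4 * ‖S₁‖ + 1 := by exact_mod_cast hm
    have h4 : S₁ = S₁.re + S₁.im * I := (re_add_im S₁).symm
    rw [hW]
    linear_combination (1 / 2 + Complex.exp (φ * I) / 8) * h1 + I / 2 * h2 - h3 / 2 + h4 / 2
  refine (norm_linear_expansion_sub_le (by linarith) hl.le hε0 hWK hA₀ hA₁ hE' hT).trans ?_
  exact div_le_div_of_nonneg_right (by linarith) hL0.le
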